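/- arXiv:1110.3496 — 4 statements merged into one kernel-verified Lean document; each statement's English description precedes it below -/
import Mathlib

section
/- Let k ≥ 2 and let r be a natural number with 1 ≤ r ≤ k. Then for all real P ≥ 2, the sum of |x_1^k − y_1^k|^{−1} over all (x,y) ∈ 𝒮_r(P) is ≪ P^r log P, with an implicit constant depending only on k and r. -/
/-- The sum of the first `n` terms of `1 / √h` is at most `2 √n`. -/
lemma sum_range_inv_sqrt_le (n : ℕ) :
    ∑ h ∈ Finset.range n, (Real.sqrt ((h : ℝ) + 1))⁻¹ ≤ 2 * Real.sqrt n := by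
  induction n with
  | zero => simp
  | succ n ih =>
    rw [Finset.sum_range_succ]
    push_cast
    have hs : Real.sqrt n ^ 2 = n := Real.sq_sqrt (by positivity)
    have ht : Real.sqrt ((n : ℝ) + 1) ^ 2 = n + 1 := Real.sq_sqrt (by positivity)
    have htpos : 0 < Real.sqrt ((n : ℝ) + 1) := Real.sqrt_pos.2 (by positivity)
    have key : (Real.sqrt ((n : ℝ) + 1))⁻¹ ≤ 2 * Real.sqrt ((n : ℝ) + 1) - 2 * Real.sqrt n := by
      rw [inv_le_iff_one_le_mul₀ htpos]
      nlinarith [sq_nonneg (Real.sqrt ((n : ℝ) + 1) - Real.sqrt n)]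
    linarith

/-- The weight `((|x| - |y|) |x|)^(-1/2)`; by the conventions for `√` and `⁻¹` it vanishes
unless `|y| < |x|`. -/
noncomputable def gapWeight (x y : ℤ) : ℝ :=
  (Real.sqrt (((x.natAbs : ℝ) - y.natAbs) * x.natAbs))⁻¹

lemma gapWeight_nonneg (x y : ℤ) : 0 ≤ gapWeight x y := by
  unfold gapWeight; positivity

lemma sum_gapWeight_le (N : ℕ) (x : ℤ) (hx : x.natAbs ≤ N) :
    ∑ y ∈ Finset.Icc (-(N : ℤ)) N, gapWeight x y ≤ 4 := by
  have h0 := gapWeight_nonneg x 0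
  rw [Finset.sum_Icc_of_even_eq_range (fun y => by simp [gapWeight])]
  have hsub : Finset.range x.natAbs ⊆ Finset.range (N + 1) :=
    Finset.range_subset_range.2 (by omega)
  rw [← Finset.sum_subset hsub]
  · rw [← Finset.sum_range_reflect]
    have hterm : ∀ h ∈ Finset.range x.natAbs,
        gapWeight x ((x.natAbs - 1 - h : ℕ) : ℤ) =
          (Real.sqrt ((h : ℝ) + 1))⁻¹ * (Real.sqrt x.natAbs)⁻¹ := by
      intro h hh
      rw [Finset.mem_range] at hh
      obtain ⟨d, hd⟩ : ∃ d, x.natAbs = h + 1 + d := ⟨x.natAbs - (h + 1), by omega⟩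
      have e : x.natAbs - 1 - h = d := by omega
      rw [e, gapWeight, Int.natAbs_natCast, Real.sqrt_mul, mul_inv]
      · congr 3
        rw [hd]; push_cast; ring
      · rw [hd]; push_cast; linarith [(Nat.cast_nonneg h : (0 : ℝ) ≤ h)]
    rw [Finset.sum_congr rfl hterm, ← Finset.sum_mul]
    have h2 := sum_range_inv_sqrt_le x.natAbs
    have h3 : (∑ h ∈ Finset.range x.natAbs, (Real.sqrt ((h : ℝ) + 1))⁻¹) *
        (Real.sqrt x.natAbs)⁻¹ ≤ 2 := by
      rcases (Real.sqrt_nonneg x.natAbs).eq_or_lt with h | h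
      · rw [← h]; simp
      · rw [← div_eq_mul_inv, div_le_iff₀ h]; exact h2
    rw [nsmul_eq_mul]
    push_cast
    linarith
  · intro b _ hb
    rw [Finset.mem_range, not_lt] at hb
    have hb' : (x.natAbs : ℝ) ≤ b := by exact_mod_cast hb
    rw [gapWeight, Real.sqrt_eq_zero_of_nonpos, inv_zero]
    rw [Int.natAbs_natCast]
    exact mul_nonpos_of_nonpos_of_nonneg (by linarith) (by positivity)

/-- A difference of `k`-th powers dominates `((a - b) a)^(k/2)`. -/
lemma mul_pow_le_sq_sub_pow {a b : ℝ} (hb : 0 ≤ b) (hab : b ≤ a) {k : ℕ} (hk : 2 ≤ k) :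
    ((a - b) * a) ^ k ≤ (a ^ k - b ^ k) ^ 2 := by
  obtain ⟨m, rfl⟩ : ∃ m, k = m + 2 := ⟨k - 2, by omega⟩
  have ha : 0 ≤ a := hb.trans hab
  have hd : 0 ≤ a - b := by linarith
  have h1 : (a - b) * a ^ (m + 1) ≤ a ^ (m + 2) - b ^ (m + 2) := by
    have : b * b ^ (m + 1) ≤ b * a ^ (m + 1) := by gcongr
    rw [pow_succ' a (m + 1), pow_succ' b (m + 1)]; linarith
  calc ((a - b) * a) ^ (m + 2) = (a - b) ^ 2 * a ^ (m + 2) * (a - b) ^ m := by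
        rw [mul_pow]; ring
    _ ≤ (a - b) ^ 2 * a ^ (m + 2) * a ^ m := by gcongr; linarith
    _ = ((a - b) * a ^ (m + 1)) ^ 2 := by ring
    _ ≤ _ := by gcongr

lemma rpow_abs_pow_sub_pow_le_gapWeight {k r : ℕ} (hk : 2 ≤ k) (hr : 1 ≤ r) (hrk : r ≤ k)
    {x y : ℤ} (hxy : y.natAbs < x.natAbs) :
    ((|x ^ k - y ^ k| : ℤ) : ℝ) ^ (-(1 / r : ℝ)) ≤ gapWeight x y := by
  have hlt : (y.natAbs : ℝ) < x.natAbs := by exact_mod_cast hxy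
  have hy : (0 : ℝ) ≤ y.natAbs := by positivity
  have hk0 : (0 : ℝ) < k := by positivity
  have hr0 : (0 : ℝ) < r := by positivity
  have hpos : 0 < ((x.natAbs : ℝ) - y.natAbs) * x.natAbs :=
    mul_pos (by linarith) (by linarith)
  have hlow : (x.natAbs : ℝ) ^ k - (y.natAbs : ℝ) ^ k ≤ ((|x ^ k - y ^ k| : ℤ) : ℝ) := by
    have := abs_sub_abs_le_abs_sub (x ^ k) (y ^ k)
    rw [abs_pow, abs_pow, Int.abs_eq_natAbs x, Int.abs_eq_natAbs y] at this
    exact_mod_cast this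
  have hd : (0 : ℝ) < (x.natAbs : ℝ) ^ k - (y.natAbs : ℝ) ^ k :=
    sub_pos.2 (pow_lt_pow_left₀ hlt hy (by omega))
  have hf0 : (0 : ℝ) < ((|x ^ k - y ^ k| : ℤ) : ℝ) := hd.trans_le hlow
  have hf1 : (1 : ℝ) ≤ ((|x ^ k - y ^ k| : ℤ) : ℝ) := by
    have : (0 : ℤ) < |x ^ k - y ^ k| := by exact_mod_cast hf0
    exact_mod_cast this
  set f : ℝ := ((|x ^ k - y ^ k| : ℤ) : ℝ)
  have hsq : (((x.natAbs : ℝ) - y.natAbs) * x.natAbs) ^ k ≤ f ^ 2 :=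
    (mul_pow_le_sq_sub_pow hy hlt.le hk).trans (by gcongr)
  have hroot : Real.sqrt (((x.natAbs : ℝ) - y.natAbs) * x.natAbs) ≤ f ^ (1 / k : ℝ) := by
    refine Real.sqrt_le_left (by positivity) |>.2 ?_
    refine le_of_pow_le_pow_left₀ (by omega : k ≠ 0) (by positivity) ?_
    refine hsq.trans_eq ?_
    rw [← pow_mul, mul_comm 2 k, pow_mul, one_div, Real.rpow_inv_natCast_pow hf0.le (by omega)]
  rw [Real.rpow_neg hf0.le, gapWeight]
  refine inv_anti₀ (Real.sqrt_pos.2 hpos) (hroot.trans ?_)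
  refine Real.rpow_le_rpow_of_exponent_le hf1 ?_
  exact one_div_le_one_div_of_le hr0 (by exact_mod_cast hrk)

/-- The weight `|x^k - y^k|^(-1/r)`, set to zero when `x^k = y^k`. -/
noncomputable def powGapWeight (k r : ℕ) (x y : ℤ) : ℝ :=
  if x ^ k = y ^ k then 0 else ((|x ^ k - y ^ k| : ℤ) : ℝ) ^ (-(1 / r : ℝ))

lemma powGapWeight_nonneg (k r : ℕ) (x y : ℤ) : 0 ≤ powGapWeight k r x y := by
  unfold powGapWeight
  split_ifs
  · exact le_rfl
  · exact Real.rpow_nonneg (by exact_mod_cast abs_nonneg _) _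

lemma powGapWeight_le {k r : ℕ} (hk : 2 ≤ k) (hr : 1 ≤ r) (hrk : r ≤ k) (x y : ℤ) :
    powGapWeight k r x y ≤ gapWeight x y + gapWeight y x + if y = -x then 1 else 0 := by
  have h1 := gapWeight_nonneg x y
  have h2 := gapWeight_nonneg y x
  have h3 : (0 : ℝ) ≤ if y = -x then 1 else 0 := by split_ifs <;> norm_num
  unfold powGapWeight
  split_ifs with h
  · positivity
  · positivity
  · rename_i hyx
    have : (1 : ℝ) ≤ ((|x ^ k - y ^ k| : ℤ) : ℝ) := by
      exact_mod_cast Int.one_le_abs (sub_ne_zero.2 h)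
    have := Real.rpow_le_one_of_one_le_of_nonpos this
      (neg_nonpos.2 (by positivity : (0 : ℝ) ≤ 1 / r))
    linarith
  · rename_i hyx
    rcases lt_trichotomy x.natAbs y.natAbs with hlt | heq | hlt
    · have := rpow_abs_pow_sub_pow_le_gapWeight hk hr hrk hlt
      rw [abs_sub_comm] at this
      linarith
    · rcases Int.natAbs_eq_natAbs_iff.1 heq with e | e
      · exact absurd (by rw [e]) h
      · exact absurd (by rw [e, neg_neg]) hyx
    · have := rpow_abs_pow_sub_pow_le_gapWeight hk hr hrk hlt
      linarith

lemma sum_powGapWeight_le {k r : ℕ} (hk : 2 ≤ k) (hr : 1 ≤ r) (hrk : r ≤ k) (N : ℕ) :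
    ∑ x ∈ Finset.Icc (-(N : ℤ)) N, ∑ y ∈ Finset.Icc (-(N : ℤ)) N, powGapWeight k r x y
      ≤ 9 * (2 * N + 1) := by
  have hcard : ((Finset.Icc (-(N : ℤ)) N).card : ℝ) = 2 * N + 1 := by
    rw [Int.card_Icc]
    have : ((N : ℤ) + 1 - -(N : ℤ)).toNat = 2 * N + 1 := by omega
    rw [this]; push_cast; ring
  have hu : ∑ x ∈ Finset.Icc (-(N : ℤ)) N, ∑ y ∈ Finset.Icc (-(N : ℤ)) N, gapWeight x y
      ≤ 4 * (2 * N + 1) := by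
    have := Finset.sum_le_card_nsmul (Finset.Icc (-(N : ℤ)) N)
      (fun x => ∑ y ∈ Finset.Icc (-(N : ℤ)) N, gapWeight x y) 4
      (fun x hx => sum_gapWeight_le N x (by rw [Finset.mem_Icc] at hx; omega))
    rw [nsmul_eq_mul, hcard] at this
    linarith
  have hd : ∑ x ∈ Finset.Icc (-(N : ℤ)) N, ∑ y ∈ Finset.Icc (-(N : ℤ)) N,
      (if y = -x then (1 : ℝ) else 0) ≤ 2 * N + 1 := by
    have := Finset.sum_le_card_nsmul (Finset.Icc (-(N : ℤ)) N)
      (fun x => ∑ y ∈ Finset.Icc (-(N : ℤ)) N, (if y = -x then (1 : ℝ) else 0)) 1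
      (fun x hx => by rw [Finset.sum_ite_eq']; split_ifs <;> norm_num)
    rw [nsmul_eq_mul, hcard] at this
    linarith
  have hle := Finset.sum_le_sum fun x (_ : x ∈ Finset.Icc (-(N : ℤ)) N) =>
    Finset.sum_le_sum fun y (_ : y ∈ Finset.Icc (-(N : ℤ)) N) => powGapWeight_le hk hr hrk x y
  simp only [Finset.sum_add_distrib] at hle
  rw [Finset.sum_comm (f := fun x y => gapWeight y x)] at hle
  linarith


/-- For k ≥ 2 and 1 ≤ r ≤ k, the sum of |x_1^k − y_1^k|^{−1} over all pairs
(x,y) ∈ 𝒮_r(P), i.e. x, y ∈ ℤ^r with |x_j| ≤ P, |y_j| ≤ P and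
|x_1^k − y_1^k| ≥ … ≥ |x_r^k − y_r^k| ≥ 1, is ≪ P^r log P, uniformly in P ≥ 2. -/
theorem stmt2 (k r : ℕ) (hk : 2 ≤ k) (hr1 : 1 ≤ r) (hrk : r ≤ k) :
    ∃ c : ℝ, 0 < c ∧ ∀ P : ℝ, 2 ≤ P →
      ∑ p ∈ ((Fintype.piFinset fun _ : Fin r => Finset.Icc (-(⌊P⌋ : ℤ)) ⌊P⌋) ×ˢ
              (Fintype.piFinset fun _ : Fin r => Finset.Icc (-(⌊P⌋ : ℤ)) ⌊P⌋)).filter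
            (fun p => (∀ i j : Fin r, i ≤ j →
                |(p.1 j) ^ k - (p.2 j) ^ k| ≤ |(p.1 i) ^ k - (p.2 i) ^ k|) ∧
              1 ≤ |(p.1 ⟨r - 1, by omega⟩) ^ k - (p.2 ⟨r - 1, by omega⟩) ^ k|),
        ((|(p.1 ⟨0, by omega⟩) ^ k - (p.2 ⟨0, by omega⟩) ^ k| : ℤ) : ℝ)⁻¹
      ≤ c * P ^ r * Real.log P := by
  have hr0 : (r : ℝ) ≠ 0 := by positivity
  refine ⟨27 ^ r / Real.log 2, by positivity, fun P hP => ?_⟩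
  obtain ⟨N, hN⟩ : ∃ N : ℕ, ⌊P⌋ = N :=
    ⟨⌊P⌋.toNat, (Int.toNat_of_nonneg (Int.floor_nonneg.2 (by linarith))).symm⟩
  have hNP : (N : ℝ) ≤ P := by
    have := Int.floor_le P
    rw [hN] at this
    exact_mod_cast this
  rw [hN]
  set I : Finset ℤ := Finset.Icc (-(N : ℤ)) N
  have hpt : ∀ p : (Fin r → ℤ) × (Fin r → ℤ),
      ((∀ i j : Fin r, i ≤ j → |(p.1 j) ^ k - (p.2 j) ^ k| ≤ |(p.1 i) ^ k - (p.2 i) ^ k|) ∧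
        1 ≤ |(p.1 ⟨r - 1, by omega⟩) ^ k - (p.2 ⟨r - 1, by omega⟩) ^ k|) →
      ((|(p.1 ⟨0, by omega⟩) ^ k - (p.2 ⟨0, by omega⟩) ^ k| : ℤ) : ℝ)⁻¹
        ≤ ∏ i, powGapWeight k r (p.1 i) (p.2 i) := by
    rintro ⟨x, y⟩ ⟨hmono, hlast⟩
    have hone : ∀ i, 1 ≤ |x i ^ k - y i ^ k| := fun i =>
      hlast.trans (hmono i _ (Fin.mk_le_mk.2 (by omega)))
    have hF : (0 : ℝ) < ((|x ⟨0, by omega⟩ ^ k - y ⟨0, by omega⟩ ^ k| : ℤ) : ℝ) := by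
      exact_mod_cast (hone ⟨0, by omega⟩)
    calc ((|x ⟨0, by omega⟩ ^ k - y ⟨0, by omega⟩ ^ k| : ℤ) : ℝ)⁻¹
        = ∏ _i : Fin r,
          ((|x ⟨0, by omega⟩ ^ k - y ⟨0, by omega⟩ ^ k| : ℤ) : ℝ) ^ (-(1 / r : ℝ)) := by
          rw [Finset.prod_const, Finset.card_univ, Fintype.card_fin, ← Real.rpow_mul_natCast hF.le,
            neg_mul, one_div_mul_cancel hr0, Real.rpow_neg_one]
      _ ≤ ∏ i, powGapWeight k r (x i) (y i) := by
          refine Finset.prod_le_prod (fun i _ => by positivity) fun i _ => ?_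
          have hi := hone i
          have hne : x i ^ k ≠ y i ^ k := by
            intro h
            rw [h, sub_self, abs_zero] at hi
            omega
          rw [powGapWeight, if_neg hne]
          refine Real.rpow_le_rpow_of_nonpos (by exact_mod_cast hi) ?_
            (neg_nonpos.2 (by positivity))
          exact_mod_cast hmono ⟨0, by omega⟩ i (Fin.mk_le_mk.2 (by omega))
  refine (Finset.sum_le_sum fun p hp => hpt p (Finset.mem_filter.1 hp).2).trans ?_
  refine (Finset.sum_le_sum_of_subset_of_nonneg (Finset.filter_subset _ _) fun p _ _ =>
    Finset.prod_nonneg fun i _ => powGapWeight_nonneg _ _ _ _).trans ?_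
  rw [Finset.sum_product]
  have hfactor : ∑ x ∈ Fintype.piFinset (fun _ : Fin r => I),
      ∑ y ∈ Fintype.piFinset (fun _ : Fin r => I), ∏ i, powGapWeight k r (x i) (y i) =
        (∑ x ∈ I, ∑ y ∈ I, powGapWeight k r x y) ^ r := by
    simp_rw [← Finset.prod_univ_sum (fun _ : Fin r => I)]
    rw [← Finset.prod_univ_sum (fun _ : Fin r => I)
      (fun _ a => ∑ y ∈ I, powGapWeight k r a y)]
    simp
  rw [hfactor]
  have hlog2 : 0 < Real.log 2 := Real.log_pos (by norm_num)
  have hlog : Real.log 2 ≤ Real.log P := Real.log_le_log (by norm_num) hP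
  calc (∑ x ∈ I, ∑ y ∈ I, powGapWeight k r x y) ^ r ≤ (27 * P) ^ r := by
        refine pow_le_pow_left₀ (Finset.sum_nonneg fun x _ => Finset.sum_nonneg fun y _ =>
          powGapWeight_nonneg _ _ _ _) ?_ r
        have := sum_powGapWeight_le hk hr1 hrk N
        linarith
    _ = 27 ^ r / Real.log 2 * P ^ r * Real.log 2 := by
        rw [mul_pow]; field_simp
    _ ≤ 27 ^ r / Real.log 2 * P ^ r * Real.log P := by
        gcongr
end

section
/- Let k ≥ 2 be a natural number and C ≥ 1 a real number. Then, uniformly for 0 < η ≤ 2 and P ≥ 2, one has Ξ := ∫_{[−C,C]^{2k}} ∫_{−∞}^{∞} |f(λ_1 α) f(λ_2 α) ⋯ f(λ_{2k} α)| d_η α dλ ≪ P^k log P, where f(α) = Σ_{|x| ≤ P} e(α x^k), the inner integral is against the measure d_η α, and the implicit constant depends only on k and C. -/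
open MeasureTheory

/-- e(t) = e^{2πit}. -/
noncomputable def eF (t : ℝ) : ℂ := Complex.exp (2 * Real.pi * Complex.I * t)

/-- The Weyl sum f(α) = Σ_{x ∈ ℤ, |x| ≤ P} e(α x^k). -/
noncomputable def fW (k : ℕ) (P α : ℝ) : ℂ :=
  ∑ x ∈ Finset.Icc (-(⌊P⌋ : ℤ)) ⌊P⌋, eF (α * (x : ℝ) ^ k)

/-- The measure d_η α = η (sin(πηα)/(πηα))² dα on ℝ. -/
noncomputable def dEta (η : ℝ) : Measure ℝ :=
  volume.withDensity fun α =>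
    ENNReal.ofReal (η * (Real.sin (Real.pi * η * α) / (Real.pi * η * α)) ^ 2)

/-- An integral-test bound, uniform in the scale `T`. -/
lemma sum_range_inv_one_add_sq_le {T : ℝ} (hT : 0 < T) (N : ℕ) :
    ∑ n ∈ Finset.range (N + 1), (1 + (T * n) ^ 2)⁻¹ ≤ 1 + 2 / T := by
  have hanti : AntitoneOn (fun x : ℝ => (1 + (T * x) ^ 2)⁻¹) (Set.Icc 0 (0 + (N : ℝ))) := by
    intro x hx y hy hxy
    have hx0 : 0 ≤ x := hx.1
    dsimp only
    gcongr
  have h1 := hanti.sum_le_integral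
  have h2 : ∫ x : ℝ in 0..0 + (N : ℝ), (1 + (T * x) ^ 2)⁻¹ = T⁻¹ * Real.arctan (T * N) := by
    rw [intervalIntegral.integral_comp_mul_left (fun x : ℝ => (1 + x ^ 2)⁻¹) hT.ne']
    simp [integral_inv_one_add_sq]
  rw [h2] at h1
  rw [Finset.sum_range_succ']
  have h3 : Real.arctan (T * N) ≤ 2 := by
    have := Real.arctan_lt_pi_div_two (T * N)
    have := Real.pi_le_four
    linarith
  have h4 : T⁻¹ * Real.arctan (T * N) ≤ 2 / T := by
    rw [div_eq_inv_mul]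
    gcongr
  simp only [zero_add] at h1
  simp only [Nat.cast_zero, mul_zero, ne_eq, OfNat.ofNat_ne_zero, not_false_eq_true, zero_pow,
    add_zero, inv_one]
  linarith

lemma inv_one_add_pow_le {k : ℕ} (hk : 2 ≤ k) {u : ℝ} (hu : 0 ≤ u) :
    (1 + u ^ k)⁻¹ ≤ 2 * (1 + u ^ 2)⁻¹ := by
  rw [← div_eq_mul_inv, inv_eq_one_div, div_le_div_iff₀ (by positivity) (by positivity)]
  rcases le_total u 1 with h | h
  · have := pow_le_one₀ (n := 2) hu h
    have : 0 ≤ u ^ k := by positivity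
    linarith
  · have := pow_le_pow_right₀ h hk
    nlinarith [sq_nonneg u]

lemma pow_abs_sub_abs_le {k : ℕ} (hk : k ≠ 0) (x y : ℝ) :
    |(|x| - |y|)| ^ k ≤ |x ^ k - y ^ k| := by
  have key : ∀ a b : ℝ, 0 ≤ b → b ≤ a → (a - b) ^ k ≤ a ^ k - b ^ k := by
    intro a b hb hab
    have := pow_add_pow_le (sub_nonneg.2 hab) hb hk
    rw [sub_add_cancel] at this
    linarith
  have h2 : |(|x ^ k| - |y ^ k|)| ≤ |x ^ k - y ^ k| := abs_abs_sub_abs_le _ _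
  refine le_trans ?_ h2
  rw [abs_pow, abs_pow]
  rcases le_total |y| |x| with h | h
  · rw [abs_of_nonneg (sub_nonneg.2 h)]
    exact (key _ _ (abs_nonneg _) h).trans (le_abs_self _)
  · rw [abs_sub_comm, abs_of_nonneg (sub_nonneg.2 h), abs_sub_comm]
    exact (key _ _ (abs_nonneg _) h).trans (le_abs_self _)

/-- Folding the sum over `y` along `y ↦ ||x| - |y||`, whose fibres have at most four elements. -/
lemma sum_natAbs_abs_sub_abs_le {N : ℕ} {x : ℤ} (hx : x ∈ Finset.Icc (-(N : ℤ)) N)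
    (φ : ℕ → ℝ) (hφ : ∀ n, 0 ≤ φ n) :
    ∑ y ∈ Finset.Icc (-(N : ℤ)) N, φ (|x| - |y|).natAbs
      ≤ 4 * ∑ n ∈ Finset.range (N + 1), φ n := by
  have hmaps : ∀ y ∈ Finset.Icc (-(N : ℤ)) N,
      (|x| - |y|).natAbs ∈ Finset.range (N + 1) := by
    intro y hy
    simp only [Finset.mem_Icc, Finset.mem_range] at *
    rcases abs_cases x with h | h <;> rcases abs_cases y with h' | h' <;> omega
  rw [← Finset.sum_fiberwise_of_maps_to hmaps, Finset.mul_sum]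
  refine Finset.sum_le_sum fun n _ => ?_
  rw [Finset.sum_congr rfl (g := fun _ => φ n) (by
    intro y hy
    rw [(Finset.mem_filter.1 hy).2]), Finset.sum_const, nsmul_eq_mul]
  refine mul_le_mul_of_nonneg_right ?_ (hφ n)
  have hsub : (Finset.Icc (-(N : ℤ)) N).filter (fun y => (|x| - |y|).natAbs = n)
      ⊆ {|x| + n, |x| - n, -|x| + n, -|x| - n} := by
    intro y hy
    have := (Finset.mem_filter.1 hy).2
    simp only [Finset.mem_insert, Finset.mem_singleton]
    rcases abs_cases y with h | h <;> omega
  exact_mod_cast (Finset.card_le_card hsub).trans Finset.card_le_four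

lemma continuous_eF : Continuous eF := by
  unfold eF
  fun_prop

lemma norm_eF (t : ℝ) : ‖eF t‖ = 1 := by
  unfold eF
  rw [show (2 * Real.pi * Complex.I * t : ℂ) = ((2 * Real.pi * t : ℝ) : ℂ) * Complex.I by
    push_cast; ring]
  exact Complex.norm_exp_ofReal_mul_I _

lemma eF_mul_conj_eF (s t : ℝ) : eF s * (starRingEnd ℂ) (eF t) = eF (s - t) := by
  unfold eF
  rw [← Complex.exp_conj, ← Complex.exp_add]
  congr 1
  simp only [map_mul, Complex.conj_I, Complex.conj_ofReal, Complex.ofReal_sub,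
    Complex.conj_ofNat]
  ring

lemma norm_integral_eF_le {C : ℝ} (hC : 1 ≤ C) (θ : ℝ) :
    ‖∫ l in (-C)..C, eF (l * θ)‖ ≤ 4 * C * (1 + |θ|)⁻¹ := by
  rw [← div_eq_mul_inv, le_div_iff₀ (by positivity)]
  have htriv : ‖∫ l in (-C)..C, eF (l * θ)‖ ≤ 2 * C := by
    have := intervalIntegral.norm_integral_le_of_norm_le_const (a := -C) (b := C) (C := 1)
      (f := fun l => eF (l * θ)) (fun l _ => (norm_eF _).le)
    rw [abs_of_nonneg (by linarith)] at this
    linarith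
  have hosc : ‖∫ l in (-C)..C, eF (l * θ)‖ * |θ| ≤ 1 := by
    rcases eq_or_ne θ 0 with rfl | hθ
    · simp
    have hc : (2 * Real.pi * Complex.I * θ : ℂ) ≠ 0 := by
      simp [Real.pi_ne_zero, hθ]
    have h : ∀ l : ℝ, eF (l * θ) = Complex.exp ((2 * Real.pi * Complex.I * θ) * l) := by
      intro l
      unfold eF
      push_cast
      ring_nf
    have hn : ∀ l : ℝ, ‖Complex.exp ((2 * Real.pi * Complex.I * θ) * l)‖ = 1 := by
      intro l
      rw [← h, norm_eF]
    simp_rw [h]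
    rw [integral_exp_mul_complex hc, norm_div]
    have hden : ‖(2 * Real.pi * Complex.I * θ : ℂ)‖ = 2 * Real.pi * |θ| := by
      simp [abs_of_pos Real.pi_pos]
    have hnum := norm_sub_le (Complex.exp ((2 * Real.pi * Complex.I * θ) * (C : ℝ)))
      (Complex.exp ((2 * Real.pi * Complex.I * θ) * ((-C : ℝ) : ℂ)))
    rw [hn, hn] at hnum
    have hθ' : 0 < |θ| := abs_pos.2 hθ
    rw [hden, div_mul_eq_mul_div, div_le_one (by positivity)]
    have := Real.pi_gt_three
    nlinarith
  have := abs_nonneg θ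
  nlinarith

lemma continuous_fW (k : ℕ) (P : ℝ) : Continuous (fW k P) := by
  unfold fW
  have := continuous_eF
  fun_prop

lemma norm_fW_le (k : ℕ) {P : ℝ} (hP : 2 ≤ P) (α : ℝ) : ‖fW k P α‖ ≤ 3 * P := by
  unfold fW
  refine (norm_sum_le _ _).trans ?_
  simp only [norm_eF, Finset.sum_const, Int.card_Icc, nsmul_eq_mul, mul_one]
  have h0 : (0 : ℤ) ≤ ⌊P⌋ := Int.floor_nonneg.2 (by linarith)
  have h1 : ((⌊P⌋ + 1 - -⌊P⌋).toNat : ℝ) = 2 * (⌊P⌋ : ℝ) + 1 := by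
    have : ((⌊P⌋ + 1 - -⌊P⌋).toNat : ℤ) = 2 * ⌊P⌋ + 1 := by omega
    exact_mod_cast this
  rw [h1]
  have := Int.floor_le P
  linarith

/-- Mean square of the Weyl sum over dilates, through the spacing
`|x ^ k - y ^ k| ≥ ||x| - |y|| ^ k`. -/
lemma integral_norm_fW_sq_le {k : ℕ} (hk : 2 ≤ k) {C : ℝ} (hC : 1 ≤ C) {P : ℝ} (hP : 2 ≤ P)
    {T : ℝ} (hT : 0 < T) {α : ℝ} (hα : T ^ k = |α|) :
    ∫ l in (-C)..C, ‖fW k P (l * α)‖ ^ 2 ≤ 96 * C * P * (1 + 2 / T) := by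
  obtain ⟨N, hN⟩ : ∃ N : ℕ, ⌊P⌋ = (N : ℤ) :=
    Int.eq_ofNat_of_zero_le (Int.floor_nonneg.2 (by linarith))
  have hNP : (N : ℝ) ≤ P := by
    have := Int.floor_le P
    rw [hN] at this
    exact_mod_cast this
  set S := Finset.Icc (-(N : ℤ)) N with hS
  have hexp : ∀ l : ℝ, ((‖fW k P (l * α)‖ ^ 2 : ℝ) : ℂ)
      = ∑ x ∈ S, ∑ y ∈ S, eF (l * (α * ((x : ℝ) ^ k - (y : ℝ) ^ k))) := by
    intro l
    rw [Complex.ofReal_pow, ← Complex.mul_conj']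
    unfold fW
    rw [hN, map_sum, Finset.sum_mul_sum]
    refine Finset.sum_congr rfl fun x _ => Finset.sum_congr rfl fun y _ => ?_
    rw [eF_mul_conj_eF]
    congr 1
    ring
  have hcont : ∀ θ : ℝ, Continuous fun l : ℝ => eF (l * θ) := fun θ =>
    continuous_eF.comp (continuous_id.mul continuous_const)
  have hint : ((∫ l in (-C)..C, ‖fW k P (l * α)‖ ^ 2 : ℝ) : ℂ)
      = ∑ x ∈ S, ∑ y ∈ S, ∫ l in (-C)..C, eF (l * (α * ((x : ℝ) ^ k - (y : ℝ) ^ k))) := by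
    rw [← intervalIntegral.integral_ofReal]
    simp_rw [hexp]
    rw [intervalIntegral.integral_finsetSum fun x _ =>
      (continuous_finsetSum S fun y _ => hcont _).intervalIntegrable _ _]
    refine Finset.sum_congr rfl fun x _ => ?_
    rw [intervalIntegral.integral_finsetSum fun y _ => (hcont _).intervalIntegrable _ _]
  have hterm : ∀ x y : ℤ, ‖∫ l in (-C)..C, eF (l * (α * ((x : ℝ) ^ k - (y : ℝ) ^ k)))‖
      ≤ 8 * C * (1 + (T * ((|x| - |y|).natAbs : ℕ)) ^ 2)⁻¹ := by
    intro x y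
    refine (norm_integral_eF_le hC _).trans ?_
    have hcast : (((|x| - |y|).natAbs : ℕ) : ℝ) = |(|(x : ℝ)| - |(y : ℝ)|)| := by
      rw [Nat.cast_natAbs]
      push_cast
      rfl
    have h1 := pow_abs_sub_abs_le (k := k) (by omega) (x : ℝ) y
    have h2 : (T * |(|(x : ℝ)| - |(y : ℝ)|)|) ^ k ≤ |α * ((x : ℝ) ^ k - (y : ℝ) ^ k)| := by
      rw [mul_pow, abs_mul, hα]
      gcongr
    have h3 := inv_one_add_pow_le hk (u := T * |(|(x : ℝ)| - |(y : ℝ)|)|) (by positivity)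
    have h4 : (1 + |α * ((x : ℝ) ^ k - (y : ℝ) ^ k)|)⁻¹
        ≤ 2 * (1 + (T * |(|(x : ℝ)| - |(y : ℝ)|)|) ^ 2)⁻¹ := by
      refine le_trans ?_ h3
      gcongr
    rw [hcast]
    calc _ ≤ 4 * C * (2 * (1 + (T * |(|(x : ℝ)| - |(y : ℝ)|)|) ^ 2)⁻¹) := by gcongr
      _ = _ := by ring
  have hcard : (S.card : ℝ) ≤ 3 * P := by
    have : S.card = 2 * N + 1 := by
      rw [hS, Int.card_Icc]
      omega
    rw [this]
    push_cast
    linarith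
  calc ∫ l in (-C)..C, ‖fW k P (l * α)‖ ^ 2
      ≤ ‖((∫ l in (-C)..C, ‖fW k P (l * α)‖ ^ 2 : ℝ) : ℂ)‖ := by
        rw [Complex.norm_real]
        exact Real.le_norm_self _
    _ ≤ ∑ x ∈ S, ∑ y ∈ S, 8 * C * (1 + (T * ((|x| - |y|).natAbs : ℕ)) ^ 2)⁻¹ := by
        rw [hint]
        exact (norm_sum_le _ _).trans (Finset.sum_le_sum fun x _ =>
          (norm_sum_le _ _).trans (Finset.sum_le_sum fun y _ => hterm x y))
    _ ≤ ∑ x ∈ S, 32 * C * (1 + 2 / T) := by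
        refine Finset.sum_le_sum fun x hx => ?_
        rw [← Finset.mul_sum]
        have h1 := sum_natAbs_abs_sub_abs_le hx (fun n : ℕ => (1 + (T * n) ^ 2)⁻¹)
          (fun n => by positivity)
        have h2 := sum_range_inv_one_add_sq_le hT N
        calc _ ≤ 8 * C * (4 * (1 + 2 / T)) := by
              gcongr
              linarith
          _ = _ := by ring
    _ = S.card * (32 * C * (1 + 2 / T)) := by rw [Finset.sum_const, nsmul_eq_mul]
    _ ≤ 3 * P * (32 * C * (1 + 2 / T)) := by gcongr
    _ = _ := by ring

lemma sq_integral_le {C : ℝ} (hC : 0 < C) {g : ℝ → ℝ} (hg : Continuous g) :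
    (∫ l in (-C)..C, g l) ^ 2 ≤ 2 * C * ∫ l in (-C)..C, g l ^ 2 := by
  set m := (∫ l in (-C)..C, g l) / (2 * C) with hm
  have hI : ∫ l in (-C)..C, g l = 2 * C * m := by
    rw [hm]
    field_simp
  have h0 : 0 ≤ ∫ l in (-C)..C, (g l - m) ^ 2 :=
    intervalIntegral.integral_nonneg (by linarith) fun _ _ => sq_nonneg _
  have h1 : ∫ l in (-C)..C, (g l - m) ^ 2
      = (∫ l in (-C)..C, g l ^ 2) - 2 * m * (∫ l in (-C)..C, g l) + 2 * C * m ^ 2 := by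
    have : ∀ l, (g l - m) ^ 2 = g l ^ 2 - 2 * m * g l + m ^ 2 := fun l => by ring
    simp_rw [this]
    rw [intervalIntegral.integral_add, intervalIntegral.integral_sub,
      intervalIntegral.integral_const_mul, intervalIntegral.integral_const, smul_eq_mul]
    · ring
    all_goals exact Continuous.intervalIntegrable (by fun_prop) _ _
  rw [h1, hI] at h0
  rw [hI]
  nlinarith

lemma integral_norm_fW_nonneg (k : ℕ) {C : ℝ} (hC : 1 ≤ C) (P α : ℝ) :
    0 ≤ ∫ l in (-C)..C, ‖fW k P (l * α)‖ :=
  intervalIntegral.integral_nonneg (by linarith) fun _ _ => norm_nonneg _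

lemma integral_norm_fW_le (k : ℕ) {C : ℝ} (hC : 1 ≤ C) {P : ℝ} (hP : 2 ≤ P) (α : ℝ) :
    ∫ l in (-C)..C, ‖fW k P (l * α)‖ ≤ 6 * C * P := by
  have := intervalIntegral.norm_integral_le_of_norm_le_const (a := -C) (b := C) (C := 3 * P)
    (f := fun l => ‖fW k P (l * α)‖) (fun l _ => by
      rw [norm_norm]
      exact norm_fW_le k hP _)
  rw [abs_of_nonneg (by linarith)] at this
  have := (Real.le_norm_self _).trans this
  linarith

/-- The `2k`-th moment bound `P ^ k (1 + 1 / |α|)`. -/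
lemma integral_norm_fW_pow_le {k : ℕ} (hk : 2 ≤ k) {C : ℝ} (hC : 1 ≤ C) {P : ℝ} (hP : 2 ≤ P)
    {α : ℝ} (hα : α ≠ 0) :
    (∫ l in (-C)..C, ‖fW k P (l * α)‖) ^ (2 * k)
      ≤ (800 * C ^ 2) ^ k * P ^ k * (1 + |α|⁻¹) := by
  have hα' : 0 < |α| := abs_pos.2 hα
  obtain ⟨T, hT, hTα⟩ : ∃ T : ℝ, 0 < T ∧ T ^ k = |α| :=
    ⟨|α| ^ (k : ℝ)⁻¹, by positivity, Real.rpow_inv_natCast_pow hα'.le (by omega)⟩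
  have h1 := sq_integral_le (C := C) (by linarith) (g := fun l => ‖fW k P (l * α)‖)
    ((continuous_fW k P).comp (by fun_prop)).norm
  have h2 := integral_norm_fW_sq_le hk hC hP hT hTα
  have h3 : (∫ l in (-C)..C, ‖fW k P (l * α)‖) ^ 2 ≤ 800 * C ^ 2 * P * max 1 T⁻¹ := by
    calc _ ≤ 2 * C * (96 * C * P * (1 + 2 / T)) := h1.trans (by gcongr)
      _ = 192 * C ^ 2 * P * (1 + 2 * T⁻¹) := by ring
      _ ≤ 192 * C ^ 2 * P * (max 1 T⁻¹ + 2 * max 1 T⁻¹) := by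
        gcongr
        · exact le_max_left _ _
        · exact le_max_right _ _
      _ = 576 * (C ^ 2 * P * max 1 T⁻¹) := by ring
      _ ≤ 800 * (C ^ 2 * P * max 1 T⁻¹) := by
        gcongr
        norm_num
      _ = _ := by ring
  have h4 : (max 1 T⁻¹) ^ k ≤ 1 + |α|⁻¹ := by
    rcases max_cases 1 T⁻¹ with ⟨h, _⟩ | ⟨h, _⟩
    · rw [h, one_pow]
      have : 0 ≤ |α|⁻¹ := by positivity
      linarith
    · rw [h, inv_pow, hTα]
      linarith
  calc _ = ((∫ l in (-C)..C, ‖fW k P (l * α)‖) ^ 2) ^ k := by rw [pow_mul]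
    _ ≤ (800 * C ^ 2 * P * max 1 T⁻¹) ^ k := by gcongr
    _ = (800 * C ^ 2) ^ k * P ^ k * (max 1 T⁻¹) ^ k := by rw [mul_pow, mul_pow]
    _ ≤ _ := by gcongr

/-- The density of `dEta η` with respect to Lebesgue measure. -/
noncomputable def etaDensity (η α : ℝ) : ℝ :=
  η * (Real.sin (Real.pi * η * α) / (Real.pi * η * α)) ^ 2

lemma sq_sin_div_le_one (t : ℝ) : (Real.sin t / t) ^ 2 ≤ 1 := by
  rw [sq_le_one_iff_abs_le_one, abs_div]
  exact div_le_one_of_le₀ Real.abs_sin_le_abs (abs_nonneg _)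

lemma sq_sin_div_le (t : ℝ) : (Real.sin t / t) ^ 2 ≤ 2 * (1 + t ^ 2)⁻¹ := by
  have h1 := sq_sin_div_le_one t
  have h2 : (Real.sin t / t) ^ 2 * t ^ 2 ≤ 1 := by
    rcases eq_or_ne t 0 with rfl | ht
    · simp
    rw [div_pow, div_mul_cancel₀ _ (by positivity)]
    exact Real.sin_sq_le_one t
  rw [← div_eq_mul_inv, le_div_iff₀ (by positivity)]
  linarith

lemma etaDensity_nonneg {η : ℝ} (hη : 0 < η) (α : ℝ) : 0 ≤ etaDensity η α := by
  unfold etaDensity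
  positivity

lemma etaDensity_le_two {η : ℝ} (hη : 0 < η) (hη2 : η ≤ 2) (α : ℝ) : etaDensity η α ≤ 2 := by
  unfold etaDensity
  exact (mul_le_of_le_one_right hη.le (sq_sin_div_le_one _)).trans hη2

lemma etaDensity_le {η : ℝ} (hη : 0 < η) (α : ℝ) :
    etaDensity η α ≤ 2 * η * (1 + (η * α) ^ 2)⁻¹ := by
  unfold etaDensity
  have h1 := sq_sin_div_le (Real.pi * η * α)
  have h2 : (1 + (Real.pi * η * α) ^ 2)⁻¹ ≤ (1 + (η * α) ^ 2)⁻¹ := by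
    have hpi : 1 ≤ Real.pi ^ 2 := by nlinarith [Real.pi_gt_three]
    refine inv_anti₀ (by positivity) ?_
    rw [mul_assoc, mul_pow]
    nlinarith [sq_nonneg (η * α)]
  calc _ ≤ η * (2 * (1 + (η * α) ^ 2)⁻¹) := by gcongr; linarith
    _ = _ := by ring

lemma measurable_etaDensity (η : ℝ) : Measurable (etaDensity η) := by
  unfold etaDensity
  fun_prop

/-- An integrable majorant for the weighted `2k`-th moments, with `δ = P ^ (-k)`. -/
noncomputable def momentMajorant (η δ α : ℝ) : ℝ :=
  4 * (η * (1 + (η * α) ^ 2)⁻¹)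
    + 8 * (Set.Icc (-1 : ℝ) 1).indicator (fun a => (|a| + δ)⁻¹) α

lemma momentMajorant_nonneg {η δ : ℝ} (hη : 0 < η) (hδ : 0 < δ) (α : ℝ) :
    0 ≤ momentMajorant η δ α := by
  unfold momentMajorant
  have : 0 ≤ (Set.Icc (-1 : ℝ) 1).indicator (fun a => (|a| + δ)⁻¹) α :=
    Set.indicator_nonneg (fun a _ => by positivity) _
  positivity

lemma continuous_inv_abs_add {δ : ℝ} (hδ : 0 < δ) : Continuous fun a : ℝ => (|a| + δ)⁻¹ :=
  (continuous_abs.add continuous_const).inv₀ fun a =>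
    ne_of_gt (lt_add_of_nonneg_of_lt (abs_nonneg a) hδ)

lemma integrable_momentMajorant {η δ : ℝ} (hη : 0 < η) (hδ : 0 < δ) :
    Integrable (momentMajorant η δ) := by
  unfold momentMajorant
  refine Integrable.add ?_ ?_
  · exact ((integrable_inv_one_add_sq.comp_mul_left' hη.ne').const_mul η).const_mul 4
  · refine Integrable.const_mul ?_ 8
    rw [integrable_indicator_iff measurableSet_Icc]
    exact (continuous_inv_abs_add hδ).continuousOn.integrableOn_Icc

lemma integral_momentMajorant {η δ : ℝ} (hη : 0 < η) (hδ : 0 < δ) :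
    ∫ α, momentMajorant η δ α = 4 * Real.pi + 16 * Real.log ((1 + δ) / δ) := by
  unfold momentMajorant
  have hhalf : ∫ a in (0 : ℝ)..1, (|a| + δ)⁻¹ = Real.log ((1 + δ) / δ) := by
    have : ∫ a in (0 : ℝ)..1, (|a| + δ)⁻¹ = ∫ a in (0 : ℝ)..1, (a + δ)⁻¹ := by
      refine intervalIntegral.integral_congr fun a ha => ?_
      rw [Set.uIcc_of_le zero_le_one] at ha
      simp only [abs_of_nonneg ha.1]
    rw [this, intervalIntegral.integral_comp_add_right (fun x => x⁻¹), zero_add,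
      integral_inv_of_pos hδ (by positivity)]
  have hneg : ∫ a in (-1 : ℝ)..0, (|a| + δ)⁻¹ = ∫ a in (0 : ℝ)..1, (|a| + δ)⁻¹ := by
    have := intervalIntegral.integral_comp_neg (a := 0) (b := 1) fun a : ℝ => (|a| + δ)⁻¹
    simpa using this.symm
  rw [integral_add ((integrable_inv_one_add_sq.comp_mul_left' hη.ne').const_mul η |>.const_mul 4)
    (Integrable.const_mul ((integrable_indicator_iff measurableSet_Icc).2
      (continuous_inv_abs_add hδ).continuousOn.integrableOn_Icc) 8),
    integral_const_mul, integral_const_mul, integral_const_mul,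
    Measure.integral_comp_mul_left (fun x : ℝ => (1 + x ^ 2)⁻¹), integral_univ_inv_one_add_sq,
    integral_indicator measurableSet_Icc, integral_Icc_eq_integral_Ioc,
    ← intervalIntegral.integral_of_le (by norm_num),
    ← intervalIntegral.integral_add_adjacent_intervals (b := 0)
      ((continuous_inv_abs_add hδ).intervalIntegrable _ _)
      ((continuous_inv_abs_add hδ).intervalIntegrable _ _), hneg, hhalf, abs_of_pos (by positivity),
    smul_eq_mul]
  field_simp
  ring

lemma etaDensity_mul_moment_le {k : ℕ} (hk : 2 ≤ k) {C : ℝ} (hC : 1 ≤ C) {P : ℝ} (hP : 2 ≤ P)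
    {η : ℝ} (hη : 0 < η) (hη2 : η ≤ 2) (α : ℝ) :
    etaDensity η α * (∫ l in (-C)..C, ‖fW k P (l * α)‖) ^ (2 * k)
      ≤ (800 * C ^ 2) ^ k * P ^ k * momentMajorant η (P ^ k)⁻¹ α := by
  have hP0 : 0 < P := by linarith
  set δ := (P ^ k)⁻¹ with hδ
  have hδ0 : 0 < δ := by positivity
  set J := (∫ l in (-C)..C, ‖fW k P (l * α)‖) ^ (2 * k) with hJ
  set K := (800 * C ^ 2) ^ k * P ^ k with hK
  have hK0 : 0 < K := by positivity
  have hJ0 : 0 ≤ J := by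
    rw [hJ, pow_mul]
    positivity
  have hw0 := etaDensity_nonneg hη α
  have hw2 := etaDensity_le_two hη hη2 α
  have hw := etaDensity_le hη α
  have htriv : J ≤ K * δ⁻¹ := by
    have h6 : (6 * C * P) ^ 2 ≤ 800 * C ^ 2 * P * P := by nlinarith [sq_nonneg (C * P)]
    calc J ≤ (6 * C * P) ^ (2 * k) :=
          pow_le_pow_left₀ (integral_norm_fW_nonneg k hC P α) (integral_norm_fW_le k hC hP α) _
      _ = ((6 * C * P) ^ 2) ^ k := by rw [pow_mul]
      _ ≤ (800 * C ^ 2 * P * P) ^ k := by gcongr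
      _ = K * δ⁻¹ := by rw [hδ, inv_inv, hK, mul_pow, mul_pow]
  unfold momentMajorant
  have hη0 : 0 ≤ η * (1 + (η * α) ^ 2)⁻¹ := by positivity
  by_cases hα : α ∈ Set.Icc (-1 : ℝ) 1
  · rw [Set.indicator_of_mem hα]
    have hα1 : |α| ≤ 1 := abs_le.2 hα
    have hJle : J ≤ K * (4 * (|α| + δ)⁻¹) := by
      rcases le_total |α| δ with h | h
      · refine htriv.trans ?_
        gcongr
        rw [← div_eq_mul_inv, inv_eq_one_div, div_le_div_iff₀ hδ0 (by positivity)]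
        linarith
      · have hα0 : 0 < |α| := hδ0.trans_le h
        refine (integral_norm_fW_pow_le hk hC hP (abs_pos.1 hα0)).trans ?_
        rw [← hK]
        gcongr
        have h1 : (1 : ℝ) ≤ |α|⁻¹ := (one_le_inv₀ hα0).2 hα1
        have h2 : 2 * |α|⁻¹ ≤ 4 * (|α| + δ)⁻¹ := by
          rw [← div_eq_mul_inv, ← div_eq_mul_inv, div_le_div_iff₀ hα0 (by positivity)]
          linarith
        linarith
    calc _ ≤ 2 * (K * (4 * (|α| + δ)⁻¹)) := by gcongr
      _ = K * (8 * (|α| + δ)⁻¹) := by ring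
      _ ≤ _ := by
        gcongr
        linarith
  · rw [Set.indicator_of_notMem hα, mul_zero, add_zero]
    have hα1 : 1 < |α| := by
      by_contra! h
      exact hα (abs_le.1 h)
    have hJle : J ≤ K * 2 := by
      refine (integral_norm_fW_pow_le hk hC hP (abs_pos.1 (by linarith))).trans ?_
      rw [← hK]
      gcongr
      have := inv_le_one_of_one_le₀ hα1.le
      linarith
    calc _ ≤ 2 * η * (1 + (η * α) ^ 2)⁻¹ * (K * 2) := by gcongr
      _ = _ := by ring

lemma setLIntegral_pi_nnnorm_prod (n k : ℕ) {C : ℝ} (hC : 1 ≤ C) (P α : ℝ) :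
    ∫⁻ l in Set.univ.pi fun _ : Fin n => Set.Icc (-C) C,
      (‖∏ j, fW k P (l j * α)‖₊ : ENNReal)
      = ENNReal.ofReal ((∫ l in (-C)..C, ‖fW k P (l * α)‖) ^ n) := by
  have hcont : Continuous fun l : ℝ => ‖fW k P (l * α)‖ :=
    ((continuous_fW k P).comp (by fun_prop)).norm
  have hint : Integrable (fun l : ℝ => ‖fW k P (l * α)‖) (volume.restrict (Set.Icc (-C) C)) :=
    hcont.continuousOn.integrableOn_Icc
  rw [volume_pi, Measure.restrict_pi_pi, intervalIntegral.integral_of_le (by linarith),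
    ← integral_Icc_eq_integral_Ioc]
  have hprod := integral_fintype_prod_eq_prod
    (μ := fun _ : Fin n => volume.restrict (Set.Icc (-C) C))
    (fun (_ : Fin n) (l : ℝ) => ‖fW k P (l * α)‖)
  rw [Finset.prod_const, Finset.card_univ, Fintype.card_fin] at hprod
  rw [← hprod, ofReal_integral_eq_lintegral_ofReal
    (Integrable.fintype_prod fun _ => hint)
    (Filter.Eventually.of_forall fun l => Finset.prod_nonneg fun _ _ => norm_nonneg _)]
  refine lintegral_congr fun l => ?_
  rw [← norm_prod, ofReal_norm]
  rfl

/-- For k ≥ 2, C ≥ 1, uniformly for 0 < η ≤ 2 and P ≥ 2: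
Ξ = ∫_{[−C,C]^{2k}} ∫ |f(λ_1α)⋯f(λ_{2k}α)| d_ηα dλ ≪ P^k log P. -/
theorem stmt3 (k : ℕ) (hk : 2 ≤ k) (C : ℝ) (hC : 1 ≤ C) :
    ∃ c : ℝ, 0 < c ∧ ∀ P : ℝ, 2 ≤ P → ∀ η : ℝ, 0 < η → η ≤ 2 →
      (∫⁻ l in Set.univ.pi fun _ : Fin (2 * k) => Set.Icc (-C) C,
          ∫⁻ α, (‖∏ j, fW k P (l j * α)‖₊ : ENNReal) ∂dEta η)
      ≤ ENNReal.ofReal (c * P ^ k * Real.log P) := by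
  refine ⟨(800 * C ^ 2) ^ k * (32 + 16 * (k + 1)), by positivity, fun P hP η hη hη2 => ?_⟩
  have hP0 : 0 < P := by linarith
  have hδ0 : 0 < (P ^ k)⁻¹ := by positivity
  have hw : Measurable fun α => ENNReal.ofReal (etaDensity η α) :=
    (measurable_etaDensity η).ennreal_ofReal
  have hdEta : dEta η = volume.withDensity fun α => ENNReal.ofReal (etaDensity η α) := rfl
  have hcont : Continuous (Function.uncurry fun (l : Fin (2 * k) → ℝ) (α : ℝ) =>
      ∏ j, fW k P (l j * α)) := by
    have := continuous_fW k P
    unfold Function.uncurry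
    fun_prop
  have hmom : Measurable fun α : ℝ =>
      ENNReal.ofReal ((∫ l in (-C)..C, ‖fW k P (l * α)‖) ^ (2 * k)) := by
    have : Continuous fun α : ℝ => ∫ l in (-C)..C, ‖fW k P (l * α)‖ := by
      refine intervalIntegral.continuous_parametric_intervalIntegral_of_continuous' ?_ _ _
      have := continuous_fW k P
      unfold Function.uncurry
      fun_prop
    exact (this.pow _).measurable.ennreal_ofReal
  have hlog : 1 / 2 ≤ Real.log P := by
    have h1 := Real.log_two_gt_d9
    have h2 := Real.log_le_log two_pos hP
    linarith
  have hlog2 : Real.log ((1 + (P ^ k)⁻¹) / (P ^ k)⁻¹) ≤ (k + 1) * Real.log P := by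
    have h1 : (1 + (P ^ k)⁻¹) / (P ^ k)⁻¹ = P ^ k + 1 := by
      field_simp
    have h2 : P ^ k + 1 ≤ P ^ (k + 1) := by
      have : 1 ≤ P ^ k := one_le_pow₀ (by linarith)
      rw [pow_succ]
      nlinarith
    have h3 := Real.log_le_log (by positivity) h2
    rw [Real.log_pow] at h3
    rw [h1]
    exact_mod_cast h3
  rw [hdEta, lintegral_lintegral_swap hcont.measurable.nnnorm.coe_nnreal_ennreal.aemeasurable]
  simp_rw [setLIntegral_pi_nnnorm_prod (2 * k) k hC P]
  rw [lintegral_withDensity_eq_lintegral_mul _ hw hmom]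
  calc ∫⁻ α, ((fun α => ENNReal.ofReal (etaDensity η α)) * fun α : ℝ =>
        ENNReal.ofReal ((∫ l in (-C)..C, ‖fW k P (l * α)‖) ^ (2 * k))) α
      ≤ ∫⁻ α, ENNReal.ofReal ((800 * C ^ 2) ^ k * P ^ k * momentMajorant η (P ^ k)⁻¹ α) := by
        refine lintegral_mono fun α => ?_
        rw [Pi.mul_apply, ← ENNReal.ofReal_mul (etaDensity_nonneg hη α)]
        exact ENNReal.ofReal_le_ofReal (etaDensity_mul_moment_le hk hC hP hη hη2 α)
    _ = ENNReal.ofReal (∫ α, (800 * C ^ 2) ^ k * P ^ k * momentMajorant η (P ^ k)⁻¹ α) := by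
        rw [ofReal_integral_eq_lintegral_ofReal
          ((integrable_momentMajorant hη hδ0).const_mul _)]
        refine Filter.Eventually.of_forall fun α => ?_
        have := momentMajorant_nonneg hη hδ0 α
        dsimp only [Pi.zero_apply]
        positivity
    _ ≤ _ := by
        refine ENNReal.ofReal_le_ofReal ?_
        rw [integral_const_mul, integral_momentMajorant hη hδ0]
        have hpi := Real.pi_le_four
        calc _ ≤ (800 * C ^ 2) ^ k * P ^ k * ((32 + 16 * (k + 1)) * Real.log P) := by
              gcongr
              linarith
          _ = _ := by ring
end

section
/- Let k ≥ 2 be even, s > 2k, C ≥ 2, and λ ∈ Λ_k^{(s)}(C) with σ_j = λ_j/|λ_j|. Then the function E_σ defined by the integral E_σ(β) = ∫_{ℬ(β,λ)} (β − σ_1σ_2 β_2 − … − σ_1σ_s β_s)^{1/k − 1} (β_2 β_3 ⋯ β_s)^{1/k − 1} d(β_2,…,β_s) satisfies |E_σ(β) − E_σ(0)| ≪ P^{−k} uniformly for |β| ≤ P^{−k} and λ ∈ Λ_k^{(s)}(C), with an implicit constant depending only on k, s, C. -/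
open MeasureTheory

/-- Λ_k^{(s)}: s-tuples of nonzero reals; for even k additionally some λ_i λ_j < 0. -/
def Lam (k s : ℕ) : Set (Fin s → ℝ) :=
  {l | (∀ j, l j ≠ 0) ∧ (Even k → ∃ i j, l i * l j < 0)}

/-- Λ_k^{(s)}(C) = {λ ∈ Λ_k^{(s)} : 1/C ≤ |λ_j| ≤ C}. -/
def LamC (k s : ℕ) (C : ℝ) : Set (Fin s → ℝ) :=
  {l | l ∈ Lam k s ∧ ∀ j, 1 / C ≤ |l j| ∧ |l j| ≤ C}

/-- The box ℬ(β,λ): tuples (β_2,…,β_s) with 0 ≤ β_j ≤ |λ_j| and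
0 ≤ β − σ_1σ_2β_2 − ⋯ − σ_1σ_sβ_s ≤ |λ_1|, where σ_j = λ_j/|λ_j|. -/
def Bset (s : ℕ) (hs : 1 ≤ s) (l : Fin s → ℝ) (β : ℝ) : Set (Fin (s - 1) → ℝ) :=
  {b | (∀ j : Fin (s - 1), 0 ≤ b j ∧ b j ≤ |l ⟨j.1 + 1, by have := j.isLt; omega⟩|) ∧
    0 ≤ β - ∑ j : Fin (s - 1), (l ⟨0, hs⟩ / |l ⟨0, hs⟩|) *
      (l ⟨j.1 + 1, by have := j.isLt; omega⟩ / |l ⟨j.1 + 1, by have := j.isLt; omega⟩|) * b j ∧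
    β - ∑ j : Fin (s - 1), (l ⟨0, hs⟩ / |l ⟨0, hs⟩|) *
      (l ⟨j.1 + 1, by have := j.isLt; omega⟩ / |l ⟨j.1 + 1, by have := j.isLt; omega⟩|) * b j
      ≤ |l ⟨0, hs⟩|}

/-- The integrand of E_σ(β). -/
noncomputable def EsigFn (k s : ℕ) (hs : 1 ≤ s) (l : Fin s → ℝ) (β : ℝ)
    (b : Fin (s - 1) → ℝ) : ℝ :=
  (β - ∑ j : Fin (s - 1), (l ⟨0, hs⟩ / |l ⟨0, hs⟩|) *
      (l ⟨j.1 + 1, by have := j.isLt; omega⟩ / |l ⟨j.1 + 1, by have := j.isLt; omega⟩|) * b j)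
      ^ ((1 : ℝ) / k - 1) *
    ∏ j : Fin (s - 1), (b j) ^ ((1 : ℝ) / k - 1)

/-- E_σ(β) = ∫_{ℬ(β,λ)} (β − σ_1σ_2β_2 − ⋯ − σ_1σ_sβ_s)^{1/k−1}(β_2⋯β_s)^{1/k−1} dβ_2⋯dβ_s,
with σ_j = λ_j/|λ_j|. -/
noncomputable def Esig (k s : ℕ) (hs : 1 ≤ s) (l : Fin s → ℝ) (β : ℝ) : ℝ :=
  ∫ b in Bset s hs l β, EsigFn k s hs l β b

open scoped ENNReal

/-- Splitting off one coordinate in a Lebesgue integral over a finite power of a measure. -/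
theorem lintegral_pi_insertNth {n : ℕ} (μ : Measure ℝ) [SigmaFinite μ] (i : Fin (n + 1))
    {F : (Fin (n + 1) → ℝ) → ℝ≥0∞} (hF : Measurable F) :
    ∫⁻ b, F b ∂(Measure.pi fun _ => μ) =
      ∫⁻ r, ∫⁻ x, F (i.insertNth x r) ∂μ ∂(Measure.pi fun _ : Fin n => μ) := by
  have hmp := (measurePreserving_piFinSuccAbove (fun _ : Fin (n + 1) => μ) i).symm
  rw [← hmp.lintegral_comp_emb (MeasurableEquiv.measurableEmbedding _),
    lintegral_prod_symm' _ (by fun_prop)]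
  rfl

theorem measurable_prod_apply {n : ℕ} {f : Fin n → ℝ → ℝ≥0∞} (hf : ∀ i, Measurable (f i)) :
    Measurable fun x : Fin n → ℝ => ∏ i, f i (x i) :=
  Finset.measurable_prod _ fun i _ => (hf i).comp (measurable_pi_apply i)

theorem lintegral_pi_prod {n : ℕ} (μ : Measure ℝ) [SigmaFinite μ] (f : Fin n → ℝ → ℝ≥0∞)
    (hf : ∀ i, Measurable (f i)) :
    ∫⁻ x, ∏ i, f i (x i) ∂(Measure.pi fun _ => μ) = ∏ i, ∫⁻ x, f i x ∂μ := by
  induction n with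
  | zero => simp
  | succ n ih =>
    rw [lintegral_pi_insertNth μ 0 (measurable_prod_apply hf)]
    simp_rw [Fin.prod_univ_succAbove _ 0, Fin.insertNth_apply_same,
      Fin.insertNth_apply_succAbove, Fin.zero_succAbove]
    have h1 : ∀ r : Fin n → ℝ, ∫⁻ x, f 0 x * ∏ i, f i.succ (r i) ∂μ =
        (∫⁻ x, f 0 x ∂μ) * ∏ i, f i.succ (r i) := fun r => lintegral_mul_const _ (hf 0)
    simp_rw [h1]
    rw [lintegral_const_mul _ (measurable_prod_apply fun i => hf i.succ), ih _ fun i => hf i.succ]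

/-- The point of the hyperplane `x 0 + ∑ ε j * x (j + 1) = β` with the coordinates `b` after the
first. -/
def hyperplanePoint {n : ℕ} (ε : Fin n → ℝ) (β : ℝ) (b : Fin n → ℝ) : Fin (n + 1) → ℝ :=
  Fin.cons (β - ∑ j, ε j * b j) b

/-- The integral of `∏ j, g j (x j)` over the hyperplane `x 0 + ∑ ε j * x (j + 1) = β`. -/
noncomputable def hyperplaneIntegral {n : ℕ} (ε : Fin n → ℝ) (g : Fin (n + 1) → ℝ → ℝ≥0∞)
    (β : ℝ) : ℝ≥0∞ :=
  ∫⁻ b, ∏ j, g j (hyperplanePoint ε β b j)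

theorem measurable_hyperplanePoint {n : ℕ} (ε : Fin n → ℝ) (β : ℝ) (j : Fin (n + 1)) :
    Measurable fun b => hyperplanePoint ε β b j := by
  refine Fin.cases ?_ (fun i => ?_) j
  · simp only [hyperplanePoint, Fin.cons_zero]; fun_prop
  · simp only [hyperplanePoint, Fin.cons_succ]; fun_prop

theorem measurable_prod_hyperplanePoint {n : ℕ} (ε : Fin n → ℝ) {g : Fin (n + 1) → ℝ → ℝ≥0∞}
    (hg : ∀ j, Measurable (g j)) (β : ℝ) :
    Measurable fun b => ∏ j, g j (hyperplanePoint ε β b j) :=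
  Finset.measurable_prod _ fun j _ => (hg j).comp (measurable_hyperplanePoint ε β j)

theorem prod_update_apply {ι : Type*} [Fintype ι] [DecidableEq ι] (g : ι → ℝ → ℝ≥0∞) (i : ι)
    (u : ℝ → ℝ≥0∞) (x : ι → ℝ) :
    ∏ j, Function.update g i u j (x j) = u (x i) * ∏ j ∈ Finset.univ.erase i, g j (x j) := by
  rw [← Finset.mul_prod_erase _ _ (Finset.mem_univ i), Function.update_self]
  congr 1
  refine Finset.prod_congr rfl fun j hj => ?_
  rw [Function.update_of_ne (Finset.ne_of_mem_erase hj)]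

theorem lintegral_comp_sub_sign_mul {e : ℝ} (he : e = 1 ∨ e = -1) (f : ℝ → ℝ≥0∞) (c : ℝ) :
    ∫⁻ x, f (c - e * x) = ∫⁻ x, f x := by
  rcases he with rfl | rfl
  · simpa using lintegral_sub_left_eq_self f c
  · simpa [add_comm] using lintegral_add_right_eq_self (μ := volume) f c

/-- A hyperplane integral is at most the product of all but one of the factor integrals. -/
theorem hyperplaneIntegral_le {n : ℕ} {ε : Fin n → ℝ} (hε : ∀ j, ε j = 1 ∨ ε j = -1)
    {g : Fin (n + 1) → ℝ → ℝ≥0∞} (hg : ∀ j, Measurable (g j)) {j : Fin (n + 1)}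
    (hj : ∀ x, g j x ≤ 1) (β : ℝ) :
    hyperplaneIntegral ε g β ≤ ∏ l ∈ Finset.univ.erase j, ∫⁻ x, g l x := by
  unfold hyperplaneIntegral
  induction j using Fin.cases with
  | zero =>
    have h0 : Finset.univ.erase (0 : Fin (n + 1)) = Finset.univ.map (Fin.succEmb n) := by
      ext l; induction l using Fin.cases <;> simp
    rw [h0, Finset.prod_map]
    simp only [Fin.coe_succEmb]
    rw [← lintegral_pi_prod volume _ fun i => hg i.succ]
    refine lintegral_mono fun b => ?_
    rw [Fin.prod_univ_succ]
    simp only [hyperplanePoint, Fin.cons_succ]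
    exact mul_le_of_le_one_left zero_le (hj _)
  | succ j =>
    obtain ⟨n, rfl⟩ : ∃ m, n = m + 1 := ⟨n - 1, by have := j.isLt; omega⟩
    have h0 : Finset.univ.erase j.succ =
        insert 0 (Finset.univ.map (j.succAboveEmb.trans (Fin.succEmb (n + 1)))) := by
      ext l
      induction l using Fin.cases with
      | zero => simp [(Fin.succ_ne_zero j).symm]
      | succ l =>
        simp only [Finset.mem_erase, ne_eq, Fin.succ_inj, Finset.mem_univ, and_true,
          Finset.mem_insert, Fin.succ_ne_zero, Finset.mem_map, true_and, false_or,
          Function.Embedding.trans_apply, Fin.coe_succAboveEmb, Fin.coe_succEmb]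
        exact Fin.exists_succAbove_eq_iff.symm
    rw [h0, Finset.prod_insert (by simp [Fin.succ_ne_zero]), Finset.prod_map, volume_pi,
      lintegral_pi_insertNth volume j (measurable_prod_hyperplanePoint ε hg β)]
    simp only [Function.Embedding.trans_apply, Fin.coe_succAboveEmb, Fin.coe_succEmb]
    rw [← lintegral_pi_prod volume _ fun i => hg (j.succAbove i).succ,
      ← lintegral_const_mul _ (measurable_prod_apply fun i => hg (j.succAbove i).succ)]
    refine lintegral_mono fun r => ?_
    simp only
    rw [← lintegral_comp_sub_sign_mul (hε j) (g 0) (β - ∑ i, ε (j.succAbove i) * r i),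
      ← lintegral_mul_const _ (by have := hg 0; fun_prop)]
    refine lintegral_mono fun x => ?_
    simp only [hyperplanePoint]
    rw [Fin.prod_univ_succ, Fin.prod_univ_succAbove _ j, Fin.sum_univ_succAbove _ j]
    simp only [Fin.cons_zero, Fin.cons_succ, Fin.insertNth_apply_same,
      Fin.insertNth_apply_succAbove]
    rw [show β - (ε j * x + ∑ i, ε (j.succAbove i) * r i) =
      β - ∑ i, ε (j.succAbove i) * r i - ε j * x by ring]
    gcongr
    exact mul_le_of_le_one_left zero_le (hj _)

/-- Moving the hyperplane amounts to translating one factor. -/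
theorem exists_hyperplaneIntegral_update_eq {n : ℕ} {ε : Fin n → ℝ}
    (hε : ∀ j, ε j = 1 ∨ ε j = -1) (g : Fin (n + 1) → ℝ → ℝ≥0∞) (i : Fin (n + 1)) (β β' : ℝ) :
    ∃ d : ℝ, |d| = |β - β'| ∧
      hyperplaneIntegral ε (Function.update g i fun x => g i (x - d)) β =
        hyperplaneIntegral ε g β' := by
  induction i using Fin.cases with
  | zero =>
    refine ⟨β - β', rfl, lintegral_congr fun b => ?_⟩
    rw [Fin.prod_univ_succ, Fin.prod_univ_succ]
    simp only [Function.update_self, Function.update_of_ne (Fin.succ_ne_zero _), hyperplanePoint,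
      Fin.cons_zero, Fin.cons_succ]
    congr 2
    ring
  | succ i =>
    refine ⟨ε i * (β - β'), by rcases hε i with h | h <;> simp [h, abs_sub_comm], ?_⟩
    unfold hyperplaneIntegral
    rw [← lintegral_add_right_eq_self _ (Pi.single i (ε i * (β - β')) : Fin n → ℝ)]
    refine lintegral_congr fun b => ?_
    rw [Fin.prod_univ_succ, Fin.prod_univ_succ, Function.update_of_ne (Fin.succ_ne_zero _).symm]
    simp only [hyperplanePoint, Fin.cons_zero, Fin.cons_succ]
    congr 2
    · have h1 : ∑ j, ε j * (b + Pi.single i (ε i * (β - β')) : Fin n → ℝ) j =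
          ∑ j, ε j * b j + (β - β') := by
        simp only [Pi.add_apply, mul_add, Finset.sum_add_distrib]
        congr 1
        rw [Finset.sum_eq_single i (fun j _ hj => by simp [hj]) (by simp), Pi.single_eq_same]
        rcases hε i with h | h <;> simp [h]
      rw [h1]; ring
    · funext j
      by_cases hj : j = i
      · subst hj; simp
      · rw [Function.update_of_ne (by simpa using hj)]; simp [hj]

theorem volume_Ioc_diff_Ioc_add_le (m d : ℝ) :
    volume (Set.Ioc 0 m \ Set.Ioc d (m + d)) ≤ ENNReal.ofReal |d| := by
  rcases le_total 0 d with hd | hd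
  · refine (measure_mono (t := Set.Ioc 0 d) ?_).trans ?_
    · rintro x ⟨hx, hx'⟩
      simp only [Set.mem_Ioc, not_and, not_le] at hx hx' ⊢
      exact ⟨hx.1, not_lt.1 fun h => by linarith [hx' h]⟩
    · rw [Real.volume_Ioc, abs_of_nonneg hd, sub_zero]
  · refine (measure_mono (t := Set.Ioc (m + d) m) ?_).trans ?_
    · rintro x ⟨hx, hx'⟩
      simp only [Set.mem_Ioc, not_and, not_le] at hx hx' ⊢
      exact ⟨hx' (by linarith), hx.2⟩
    · rw [Real.volume_Ioc, abs_of_nonpos hd]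
      exact ENNReal.ofReal_le_ofReal (by linarith)

/-- The indicator functions of the sides `(0, m j]` of a box. -/
noncomputable def boxIndicator {ι : Type*} (m : ι → ℝ) (j : ι) : ℝ → ℝ≥0∞ :=
  (Set.Ioc 0 (m j)).indicator 1

theorem measurable_boxIndicator {ι : Type*} (m : ι → ℝ) (j : ι) :
    Measurable (boxIndicator m j) :=
  measurable_one.indicator measurableSet_Ioc

theorem boxIndicator_le_one {ι : Type*} (m : ι → ℝ) (j : ι) (x : ℝ) : boxIndicator m j x ≤ 1 :=
  Set.indicator_le_self' (fun _ _ => zero_le) x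

/-- Hyperplane sections of a box depend in a Lipschitz way on the hyperplane, with constant the
product of all side lengths but two. -/
theorem hyperplaneIntegral_boxIndicator_le {n : ℕ} {ε : Fin n → ℝ}
    (hε : ∀ j, ε j = 1 ∨ ε j = -1) (m : Fin (n + 1) → ℝ) {i j : Fin (n + 1)} (hij : i ≠ j)
    (β β' : ℝ) :
    hyperplaneIntegral ε (boxIndicator m) β ≤ hyperplaneIntegral ε (boxIndicator m) β' +
      ENNReal.ofReal |β - β'| *
        ∏ l ∈ (Finset.univ.erase j).erase i, ENNReal.ofReal (m l) := by
  obtain ⟨d, hd, hdeq⟩ := exists_hyperplaneIntegral_update_eq hε (boxIndicator m) i β β'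
  set h : ℝ → ℝ≥0∞ := (Set.Ioc 0 (m i) \ Set.Ioc d (m i + d)).indicator 1 with hh
  have hhm : Measurable h := measurable_one.indicator (measurableSet_Ioc.diff measurableSet_Ioc)
  have hum : ∀ l, Measurable (Function.update (boxIndicator m) i h l) := fun l => by
    by_cases hl : l = i
    · subst hl; simpa using hhm
    · rw [Function.update_of_ne hl]; exact measurable_boxIndicator m l
  have hle : ∀ x, boxIndicator m i x ≤ boxIndicator m i (x - d) + h x := fun x => by
    by_cases h1 : x ∈ Set.Ioc 0 (m i)
    · by_cases h2 : x - d ∈ Set.Ioc 0 (m i)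
      · simp [boxIndicator, h1, h2]
      · have : x ∈ Set.Ioc 0 (m i) \ Set.Ioc d (m i + d) :=
          ⟨h1, fun h3 => h2 ⟨by linarith [h3.1], by linarith [h3.2]⟩⟩
        rw [hh, Set.indicator_of_mem this]
        exact (boxIndicator_le_one m i x).trans le_add_self
    · simp [boxIndicator, h1]
  calc hyperplaneIntegral ε (boxIndicator m) β
      ≤ hyperplaneIntegral ε
            (Function.update (boxIndicator m) i fun x => boxIndicator m i (x - d)) β +
          hyperplaneIntegral ε (Function.update (boxIndicator m) i h) β := by
        unfold hyperplaneIntegral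
        rw [← lintegral_add_right _ (measurable_prod_hyperplanePoint ε hum β)]
        refine lintegral_mono fun b => ?_
        simp only
        rw [prod_update_apply, prod_update_apply, ← add_mul,
          ← Finset.mul_prod_erase _ _ (Finset.mem_univ i)]
        gcongr
        exact hle _
    _ ≤ _ := by
        rw [hdeq]
        gcongr
        refine (hyperplaneIntegral_le hε hum (j := j) (fun x => ?_) β).trans ?_
        · rw [Function.update_of_ne hij.symm]; exact boxIndicator_le_one m j x
        · rw [← Finset.mul_prod_erase _ _ (Finset.mem_erase.2 ⟨hij, Finset.mem_univ i⟩),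
            Function.update_self]
          gcongr with l hl
          · rw [hh, lintegral_indicator_one (measurableSet_Ioc.diff measurableSet_Ioc), ← hd]
            exact volume_Ioc_diff_Ioc_add_le _ _
          · rw [Function.update_of_ne (Finset.ne_of_mem_erase hl), boxIndicator,
              lintegral_indicator_one measurableSet_Ioc, Real.volume_Ioc, sub_zero]

/-- The product of all but two suitably chosen factors is at most the corresponding power of the
geometric mean. -/
theorem exists_prod_erase_erase_le {n : ℕ} (hn : 1 ≤ n) {m : Fin (n + 1) → ℝ}
    (hm : ∀ j, 0 < m j) :
    ∃ i j, i ≠ j ∧ ∏ l ∈ (Finset.univ.erase j).erase i, m l ≤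
      ∏ l, m l ^ (1 - 2 / ((n : ℝ) + 1)) := by
  by_contra! hcon
  have hne : ∀ i : Fin (n + 1), i ≠ i + 1 := fun i h => by
    have h1 : (1 : Fin (n + 1)) = 0 := by simpa using h.symm
    rw [Fin.one_eq_zero_iff] at h1
    omega
  have hT : 0 < ∏ l, m l := Finset.prod_pos fun l _ => hm l
  have hlt : ∏ _i : Fin (n + 1), ∏ l, m l ^ (1 - 2 / ((n : ℝ) + 1)) <
      ∏ i : Fin (n + 1), ∏ l ∈ (Finset.univ.erase (i + 1)).erase i, m l :=
    Finset.prod_lt_prod_of_nonempty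
      (fun _ _ => Finset.prod_pos fun l _ => Real.rpow_pos_of_pos (hm l) _)
      (fun i _ => hcon i (i + 1) (hne i)) Finset.univ_nonempty
  have hR : (∏ i : Fin (n + 1), ∏ l ∈ (Finset.univ.erase (i + 1)).erase i, m l) *
      (∏ l, m l) ^ 2 = (∏ l, m l) ^ (n + 1) := by
    have h1 : ∏ i : Fin (n + 1), m (i + 1) = ∏ l, m l :=
      Fintype.prod_equiv (Equiv.addRight (1 : Fin (n + 1))) _ _ fun _ => rfl
    have h2 : ∏ i : Fin (n + 1),
        (m (i + 1) * (m i * ∏ l ∈ (Finset.univ.erase (i + 1)).erase i, m l)) =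
          ∏ _i : Fin (n + 1), ∏ l, m l := by
      refine Finset.prod_congr rfl fun i _ => ?_
      rw [Finset.mul_prod_erase _ _ (Finset.mem_erase.2 ⟨hne i, Finset.mem_univ _⟩),
        Finset.mul_prod_erase _ _ (Finset.mem_univ _)]
    rw [Finset.prod_mul_distrib, Finset.prod_mul_distrib, h1, Finset.prod_const,
      Finset.card_univ, Fintype.card_fin] at h2
    rw [← h2]; ring
  have hL : (∏ _i : Fin (n + 1), ∏ l, m l ^ (1 - 2 / ((n : ℝ) + 1))) * (∏ l, m l) ^ 2 =
      (∏ l, m l) ^ (n + 1) := by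
    rw [Finset.prod_const, Finset.card_univ, Fintype.card_fin,
      Real.finsetProd_rpow _ _ fun l _ => (hm l).le, ← Real.rpow_natCast, ← Real.rpow_mul hT.le,
      ← Real.rpow_natCast _ 2, ← Real.rpow_add hT, ← Real.rpow_natCast]
    congr 1
    push_cast
    field_simp
    ring
  have := mul_lt_mul_of_pos_right hlt (pow_pos hT 2)
  rw [hL, hR] at this
  exact lt_irrefl _ this

theorem hyperplaneIntegral_boxIndicator_le_rpow {n : ℕ} (hn : 1 ≤ n) {ε : Fin n → ℝ}
    (hε : ∀ j, ε j = 1 ∨ ε j = -1) (m : Fin (n + 1) → ℝ) (β β' : ℝ) :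
    hyperplaneIntegral ε (boxIndicator m) β ≤ hyperplaneIntegral ε (boxIndicator m) β' +
      ENNReal.ofReal |β - β'| * ∏ l, ENNReal.ofReal (m l ^ (1 - 2 / ((n : ℝ) + 1))) := by
  by_cases hm : ∀ j, 0 < m j
  · obtain ⟨i, j, hij, h⟩ := exists_prod_erase_erase_le hn hm
    refine (hyperplaneIntegral_boxIndicator_le hε m hij β β').trans ?_
    rw [← ENNReal.ofReal_prod_of_nonneg fun l _ => (hm l).le,
      ← ENNReal.ofReal_prod_of_nonneg fun l _ => Real.rpow_nonneg (hm l).le _]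
    gcongr
  · push Not at hm
    obtain ⟨j, hj⟩ := hm
    have h0 : hyperplaneIntegral ε (boxIndicator m) β = 0 := by
      unfold hyperplaneIntegral
      convert lintegral_zero with b
      exact Finset.prod_eq_zero (Finset.mem_univ j)
        (by simp [boxIndicator, Set.Ioc_eq_empty_of_le hj])
    rw [h0]
    exact zero_le

/-- The measure on `(0, ∞)` whose upper tails are `x ^ r`, for negative `r`. -/
noncomputable def rpowTailMeasure (r : ℝ) : Measure ℝ :=
  (volume.restrict (Set.Ioi 0)).withDensity fun y => ENNReal.ofReal (-r * y ^ (r - 1))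

instance (r : ℝ) : SigmaFinite (rpowTailMeasure r) :=
  SigmaFinite.withDensity_ofReal _

/-- A power function cut off to `[0, L]`. -/
noncomputable def rpowCutoff (r L : ℝ) : ℝ → ℝ≥0∞ :=
  (Set.Icc 0 L).indicator fun x => ENNReal.ofReal (x ^ r)

theorem lintegral_rpowTailMeasure (r : ℝ) {f : ℝ → ℝ≥0∞} (hf : Measurable f) :
    ∫⁻ y, f y ∂(rpowTailMeasure r) =
      ∫⁻ y in Set.Ioi 0, ENNReal.ofReal (-r * y ^ (r - 1)) * f y := by
  rw [rpowTailMeasure, lintegral_withDensity_eq_lintegral_mul _ (by fun_prop) hf]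
  rfl

theorem measurable_boxIndicator_min (L x : ℝ) :
    Measurable fun y => (Set.Ioc 0 (min y L)).indicator (1 : ℝ → ℝ≥0∞) x := by
  have : (fun y => (Set.Ioc 0 (min y L)).indicator (1 : ℝ → ℝ≥0∞) x) =
      {y | 0 < x ∧ x ≤ min y L}.indicator 1 := by
    ext y; simp [Set.indicator_apply]
  rw [this]
  exact measurable_one.indicator (by measurability)

/-- Cut off negative powers are mixtures of indicator functions of intervals. -/
theorem lintegral_indicator_Ioc_rpowTailMeasure {r : ℝ} (hr : r < 0) (L x : ℝ) :
    ∫⁻ y, (Set.Ioc 0 (min y L)).indicator 1 x ∂(rpowTailMeasure r) = rpowCutoff r L x := by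
  by_cases hx : 0 < x ∧ x ≤ L
  · rw [lintegral_rpowTailMeasure r (measurable_boxIndicator_min L x)]
    have h1 : ∀ y, ENNReal.ofReal (-r * y ^ (r - 1)) *
        (Set.Ioc 0 (min y L)).indicator (1 : ℝ → ℝ≥0∞) x =
          (Set.Ici x).indicator (fun y => ENNReal.ofReal (-r * y ^ (r - 1))) y := fun y => by
      by_cases hy : x ≤ y <;> simp [hx, hy]
    simp_rw [h1]
    rw [lintegral_indicator measurableSet_Ici, Measure.restrict_restrict measurableSet_Ici,
      Set.inter_eq_left.2 (Set.Ici_subset_Ioi.2 hx.1), Measure.restrict_congr_set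
      (Ioi_ae_eq_Ici (a := x)).symm, ← ofReal_integral_eq_lintegral_ofReal, integral_const_mul,
      integral_Ioi_rpow_of_lt (by linarith) hx.1, rpowCutoff,
      Set.indicator_of_mem (show x ∈ Set.Icc 0 L from ⟨hx.1.le, hx.2⟩)]
    · congr 1
      have hr0 := hr.ne
      rw [sub_add_cancel]
      field_simp
    · exact (integrableOn_Ioi_rpow_of_lt (by linarith) hx.1).const_mul _
    · filter_upwards [ae_restrict_mem measurableSet_Ioi] with y hy
      exact mul_nonneg (by linarith) (Real.rpow_nonneg (hx.1.trans hy).le _)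
  · have h1 : ∀ y, (Set.Ioc 0 (min y L)).indicator (1 : ℝ → ℝ≥0∞) x = 0 := fun y =>
      Set.indicator_of_notMem (fun h => hx ⟨h.1, h.2.trans (min_le_right _ _)⟩) _
    simp_rw [h1]
    rw [lintegral_zero, rpowCutoff, eq_comm, Set.indicator_apply_eq_zero]
    rintro ⟨h2, h3⟩
    obtain rfl : x = 0 := le_antisymm (not_lt.1 fun h => hx ⟨h, h3⟩) h2
    rw [Real.zero_rpow hr.ne, ENNReal.ofReal_zero]

theorem hyperplaneIntegral_rpowCutoff {n : ℕ} (ε : Fin n → ℝ) {r : ℝ} (hr : r < 0)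
    (L : Fin (n + 1) → ℝ) (β : ℝ) :
    hyperplaneIntegral ε (fun j => rpowCutoff r (L j)) β =
      ∫⁻ Y, hyperplaneIntegral ε (boxIndicator fun j => min (Y j) (L j)) β
        ∂(Measure.pi fun _ => rpowTailMeasure r) := by
  unfold hyperplaneIntegral
  rw [lintegral_lintegral_swap]
  · refine lintegral_congr fun b => ?_
    simp_rw [← lintegral_indicator_Ioc_rpowTailMeasure hr]
    exact (lintegral_pi_prod _
      (fun j y => (Set.Ioc 0 (min y (L j))).indicator 1 (hyperplanePoint ε β b j))
      fun j => measurable_boxIndicator_min _ _).symm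
  · refine (Finset.measurable_prod _ fun j _ => ?_).aemeasurable
    have : (fun p : (Fin (n + 1) → ℝ) × (Fin n → ℝ) =>
        boxIndicator (fun j => min (p.1 j) (L j)) j (hyperplanePoint ε β p.2 j)) =
        {p | 0 < hyperplanePoint ε β p.2 j ∧
          hyperplanePoint ε β p.2 j ≤ min (p.1 j) (L j)}.indicator 1 := by
      ext p; simp [boxIndicator, Set.indicator_apply]
    rw [this]
    have h1 : Measurable fun p : (Fin (n + 1) → ℝ) × (Fin n → ℝ) =>
        hyperplanePoint ε β p.2 j := (measurable_hyperplanePoint ε β j).comp measurable_snd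
    have h2 : Measurable fun p : (Fin (n + 1) → ℝ) × (Fin n → ℝ) => min (p.1 j) (L j) := by
      fun_prop
    exact measurable_one.indicator
      ((measurableSet_lt measurable_const h1).inter (measurableSet_le h1 h2))

theorem lintegral_min_rpow_rpowTailMeasure_lt_top {r θ C : ℝ} (hr : r < 0) (hθ : 0 ≤ θ)
    (hrθ : 0 < r + θ) (hC : 0 < C) :
    ∫⁻ y, ENNReal.ofReal (min y C ^ θ) ∂(rpowTailMeasure r) < ∞ := by
  rw [lintegral_rpowTailMeasure r (by fun_prop), ← Set.Ioc_union_Ioi_eq_Ioi zero_le_one]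
  refine (lintegral_union_le _ _ _).trans_lt (ENNReal.add_lt_top.2 ⟨?_, ?_⟩)
  · have hint : IntegrableOn (fun y : ℝ => -r * y ^ (r - 1 + θ)) (Set.Ioc 0 1) :=
      ((intervalIntegrable_iff_integrableOn_Ioc_of_le zero_le_one).1
        (intervalIntegral.intervalIntegrable_rpow' (by linarith))).const_mul _
    refine (setLIntegral_mono' measurableSet_Ioc fun y hy => ?_).trans_lt hint.lintegral_lt_top
    rw [← ENNReal.ofReal_mul (mul_nonneg (by linarith) (Real.rpow_nonneg hy.1.le _)), mul_assoc,
      Real.rpow_add hy.1]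
    have h0 : 0 ≤ min y C := le_min hy.1.le hC.le
    have h1 : 0 ≤ y ^ (r - 1) := Real.rpow_nonneg hy.1.le _
    have h2 : 0 ≤ -r := by linarith
    gcongr
    exact min_le_left _ _
  · have hint : IntegrableOn (fun y : ℝ => -r * (y ^ (r - 1) * C ^ θ)) (Set.Ioi 1) :=
      ((integrableOn_Ioi_rpow_of_lt (by linarith) one_pos).mul_const _).const_mul _
    refine (setLIntegral_mono' measurableSet_Ioi fun y hy => ?_).trans_lt hint.lintegral_lt_top
    have hy0 : 0 < y := one_pos.trans hy
    rw [← ENNReal.ofReal_mul (mul_nonneg (by linarith) (Real.rpow_nonneg hy0.le _)), mul_assoc]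
    have h0 : 0 ≤ min y C := le_min hy0.le hC.le
    have h1 : 0 ≤ y ^ (r - 1) := Real.rpow_nonneg hy0.le _
    have h2 : 0 ≤ -r := by linarith
    gcongr
    exact min_le_right _ _

/-- Hyperplane integrals of products of cut off powers are Lipschitz functions of the hyperplane,
uniformly in the cutoffs. -/
theorem hyperplaneIntegral_rpowCutoff_le {n : ℕ} (hn : 1 ≤ n) {ε : Fin n → ℝ}
    (hε : ∀ j, ε j = 1 ∨ ε j = -1) {r C : ℝ} (hr : r < 0) {L : Fin (n + 1) → ℝ}
    (hL : ∀ j, 0 < L j) (hLC : ∀ j, L j ≤ C) (β β' : ℝ) :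
    hyperplaneIntegral ε (fun j => rpowCutoff r (L j)) β ≤
      hyperplaneIntegral ε (fun j => rpowCutoff r (L j)) β' + ENNReal.ofReal |β - β'| *
        (∫⁻ y, ENNReal.ofReal (min y C ^ (1 - 2 / ((n : ℝ) + 1)))
          ∂(rpowTailMeasure r)) ^ (n + 1) := by
  have hθ : 0 ≤ 1 - 2 / ((n : ℝ) + 1) := by
    have : (1 : ℝ) ≤ n := by exact_mod_cast hn
    rw [sub_nonneg, div_le_one (by positivity)]
    linarith
  rw [hyperplaneIntegral_rpowCutoff ε hr, hyperplaneIntegral_rpowCutoff ε hr]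
  refine (lintegral_mono fun Y =>
    hyperplaneIntegral_boxIndicator_le_rpow hn hε _ β β').trans ?_
  have hmeas : ∀ l, Measurable fun y : ℝ =>
      ENNReal.ofReal (min y (L l) ^ (1 - 2 / ((n : ℝ) + 1))) := fun l => by fun_prop
  rw [lintegral_add_right _ (by fun_prop),
    lintegral_const_mul _ (measurable_prod_apply hmeas), lintegral_pi_prod _ _ hmeas]
  gcongr
  refine (Finset.prod_le_prod' (g := fun _ => ∫⁻ y, ENNReal.ofReal
    (min y C ^ (1 - 2 / ((n : ℝ) + 1))) ∂(rpowTailMeasure r)) fun l _ => ?_).trans ?_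
  · rw [lintegral_rpowTailMeasure r (hmeas l), lintegral_rpowTailMeasure r (by fun_prop)]
    refine setLIntegral_mono' measurableSet_Ioi fun y hy => ?_
    have h0 : 0 ≤ min y (L l) := le_min (le_of_lt hy) (hL l).le
    have := hLC l
    gcongr
  · simp

theorem hyperplaneIntegral_rpowCutoff_eq_zero {n : ℕ} {ε : Fin n → ℝ}
    (hε : ∀ j, ε j = 1 ∨ ε j = -1) (r : ℝ) {L : Fin (n + 1) → ℝ} {β : ℝ}
    (hβ : ∑ j, L j < β) :
    hyperplaneIntegral ε (fun j => rpowCutoff r (L j)) β = 0 := by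
  unfold hyperplaneIntegral
  convert lintegral_zero with b
  by_contra hne
  rw [← ne_eq, Finset.prod_ne_zero_iff] at hne
  have hmem : ∀ j, hyperplanePoint ε β b j ∈ Set.Icc 0 (L j) := fun j =>
    Set.mem_of_indicator_ne_zero (hne j (Finset.mem_univ j))
  have h0 := (hmem 0).2
  have h1 : ∑ j, ε j * b j ≤ ∑ j : Fin n, L j.succ := Finset.sum_le_sum fun j _ => by
    have h2 := hmem j.succ
    simp only [hyperplanePoint, Fin.cons_succ, Set.mem_Icc] at h2
    rcases hε j with h | h <;> rw [h] <;> linarith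
  simp only [hyperplanePoint, Fin.cons_zero] at h0
  rw [Fin.sum_univ_succ] at hβ
  linarith

/-- The products of signs in the definition of `Esig`. -/
noncomputable def signRatio {n : ℕ} (l : Fin (n + 1) → ℝ) (j : Fin n) : ℝ :=
  l 0 / |l 0| * (l j.succ / |l j.succ|)

theorem signRatio_eq_one_or {n : ℕ} {l : Fin (n + 1) → ℝ} (hl : ∀ j, l j ≠ 0) (j : Fin n) :
    signRatio l j = 1 ∨ signRatio l j = -1 := by
  have h : ∀ j, l j / |l j| = 1 ∨ l j / |l j| = -1 := fun j => by
    rcases abs_choice (l j) with h | h <;> rw [h]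
    · exact Or.inl (div_self (hl j))
    · exact Or.inr (by rw [div_neg, div_self (hl j)])
  unfold signRatio
  rcases h 0 with h0 | h0 <;> rcases h j.succ with h1 | h1 <;> simp [h0, h1]

theorem mem_Bset_iff {n : ℕ} (h : 1 ≤ n + 1) (l : Fin (n + 1) → ℝ) (β : ℝ) (b : Fin n → ℝ) :
    b ∈ Bset (n + 1) h l β ↔
      ∀ j, hyperplanePoint (signRatio l) β b j ∈ Set.Icc 0 |l j| := by
  rw [Fin.forall_fin_succ, and_comm]
  rfl

theorem Esig_eq_toReal {n : ℕ} (k : ℕ) (h : 1 ≤ n + 1) (l : Fin (n + 1) → ℝ) (β : ℝ) :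
    Esig k (n + 1) h l β = (hyperplaneIntegral (signRatio l)
      (fun j => rpowCutoff ((1 : ℝ) / k - 1) |l j|) β).toReal := by
  have hcut : ∀ j, Measurable (rpowCutoff ((1 : ℝ) / k - 1) |l j|) := fun j =>
    Measurable.indicator (by fun_prop) measurableSet_Icc
  have hB : MeasurableSet (Bset (n + 1) h l β) := by
    have : Bset (n + 1) h l β = ⋂ j, {b : Fin n → ℝ |
        hyperplanePoint (signRatio l) β b j ∈ Set.Icc 0 |l j|} := by
      ext b
      rw [Set.mem_iInter]
      exact mem_Bset_iff h l β b
    rw [this]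
    exact MeasurableSet.iInter fun j => measurable_hyperplanePoint _ β j measurableSet_Icc
  unfold hyperplaneIntegral
  rw [Esig, ← integral_indicator hB, ← integral_toReal
    (measurable_prod_hyperplanePoint _ hcut β).aemeasurable
    (Filter.Eventually.of_forall fun b => ENNReal.prod_lt_top fun j _ => by
      unfold rpowCutoff Set.indicator
      split_ifs <;> simp)]
  refine integral_congr_ae (Filter.Eventually.of_forall fun (b : Fin n → ℝ) => ?_)
  simp only
  rw [ENNReal.toReal_prod]
  by_cases hb : b ∈ Bset (n + 1) h l β
  · rw [Set.indicator_of_mem hb]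
    have hmem := (mem_Bset_iff h l β b).1 hb
    have h1 : ∀ j, (rpowCutoff ((1 : ℝ) / k - 1) |l j|
        (hyperplanePoint (signRatio l) β b j)).toReal =
          hyperplanePoint (signRatio l) β b j ^ ((1 : ℝ) / k - 1) := fun j => by
      rw [rpowCutoff, Set.indicator_of_mem (hmem j),
        ENNReal.toReal_ofReal (Real.rpow_nonneg (hmem j).1 _)]
    simp_rw [h1]
    rw [Fin.prod_univ_succ]
    rfl
  · rw [Set.indicator_of_notMem hb]
    rw [mem_Bset_iff] at hb
    push Not at hb
    obtain ⟨j, hj⟩ := hb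
    refine (Finset.prod_eq_zero (Finset.mem_univ j) ?_).symm
    rw [rpowCutoff, Set.indicator_of_notMem hj, ENNReal.toReal_zero]

theorem abs_toReal_sub_toReal_le {a b d : ℝ≥0∞} (ha : a ≠ ∞) (hb : b ≠ ∞) (hd : d ≠ ∞)
    (hab : a ≤ b + d) (hba : b ≤ a + d) : |a.toReal - b.toReal| ≤ d.toReal := by
  have h1 := ENNReal.toReal_mono (ENNReal.add_ne_top.2 ⟨hb, hd⟩) hab
  have h2 := ENNReal.toReal_mono (ENNReal.add_ne_top.2 ⟨ha, hd⟩) hba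
  rw [ENNReal.toReal_add hb hd] at h1
  rw [ENNReal.toReal_add ha hd] at h2
  rw [abs_le]
  constructor <;> linarith

/-- For even k ≥ 2, s > 2k, C ≥ 2, and λ ∈ Λ_k^{(s)}(C):
|E_σ(β) − E_σ(0)| ≪ P^{−k} uniformly for |β| ≤ P^{−k} and λ ∈ Λ_k^{(s)}(C). -/
theorem stmt8 (k s : ℕ) (hk : 2 ≤ k) (hke : Even k) (hs : 2 * k < s) (C : ℝ) (hC : 2 ≤ C) :
    ∃ c : ℝ, 0 < c ∧ ∀ P : ℝ, 1 ≤ P → ∀ l ∈ LamC k s C, ∀ β : ℝ, |β| ≤ P ^ (-(k : ℝ)) →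
      |Esig k s (by omega) l β - Esig k s (by omega) l 0| ≤ c * P ^ (-(k : ℝ)) := by
  obtain ⟨n, rfl⟩ : ∃ n, s = n + 1 := ⟨s - 1, by omega⟩
  have hn : 1 ≤ n := by omega
  have hk0 : (2 : ℝ) ≤ k := by exact_mod_cast hk
  have hs0 : 2 * (k : ℝ) < n + 1 := by exact_mod_cast hs
  have hr : (1 : ℝ) / k - 1 < 0 := by
    rw [sub_neg, div_lt_one (by linarith)]
    linarith
  have hlt : 2 / ((n : ℝ) + 1) < 1 / k := by
    rw [div_lt_div_iff₀ (by linarith) (by linarith)]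
    linarith
  have hk1 : (1 : ℝ) / k ≤ 1 := by linarith
  set K : ℝ≥0∞ := (∫⁻ y, ENNReal.ofReal (min y C ^ (1 - 2 / ((n : ℝ) + 1)))
    ∂(rpowTailMeasure ((1 : ℝ) / k - 1))) ^ (n + 1)
  have hK : K ≠ ∞ := ENNReal.pow_ne_top (lintegral_min_rpow_rpowTailMeasure_lt_top hr
    (by linarith) (by linarith) (by linarith)).ne
  refine ⟨K.toReal + 1, by positivity, fun P hP l hl β hβ => ?_⟩
  have hlip := hyperplaneIntegral_rpowCutoff_le hn (signRatio_eq_one_or hl.1.1) hr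
    (fun j => abs_pos.2 (hl.1.1 j)) (fun j => (hl.2 j).2)
  have hfin : ∀ β, hyperplaneIntegral (signRatio l)
      (fun j => rpowCutoff ((1 : ℝ) / k - 1) |l j|) β ≠ ∞ := fun β => by
    refine ne_top_of_le_ne_top ?_ (hlip β (∑ j, |l j| + 1))
    rw [hyperplaneIntegral_rpowCutoff_eq_zero (signRatio_eq_one_or hl.1.1) _ (lt_add_one _),
      zero_add]
    exact ENNReal.mul_ne_top ENNReal.ofReal_ne_top hK
  rw [Esig_eq_toReal, Esig_eq_toReal]
  refine (abs_toReal_sub_toReal_le (hfin β) (hfin 0)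
    (ENNReal.mul_ne_top ENNReal.ofReal_ne_top hK) (hlip β 0)
    (by rw [abs_sub_comm]; exact hlip 0 β)).trans ?_
  rw [ENNReal.toReal_mul, ENNReal.toReal_ofReal (abs_nonneg _), sub_zero, mul_comm]
  have : 0 ≤ K.toReal := ENNReal.toReal_nonneg
  gcongr
  linarith
end

section
/- Let k ≥ 2, s > 2k and C ≥ 2. There exists a continuous function J_{k,s}: Λ_k^{(s)} → (0,∞) such that, with V_λ(α) = v(λ_1 α) ⋯ v(λ_s α), one has ∫_{−∞}^{∞} V_λ(α) d_η α = η J_{k,s}(λ) P^{s−k} + O(P^{s−2k}), uniformly for 0 < η ≤ 2 and λ ∈ Λ_k^{(s)}(C), with an implicit constant depending only on k, s, C. -/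
open MeasureTheory

/-- v(α) = ∫_{−P}^{P} e(α ξ^k) dξ. -/
noncomputable def vInt (k : ℕ) (P α : ℝ) : ℂ := ∫ ξ in (-P)..P, eF (α * ξ ^ k)

lemma eF_sum {ι : Type*} (S : Finset ι) (f : ι → ℝ) : eF (∑ i ∈ S, f i) = ∏ i ∈ S, eF (f i) := by
  simp only [eF]
  rw [← Complex.exp_sum, Complex.ofReal_sum, Finset.mul_sum]

lemma hasDerivAt_eF_pow (n : ℕ) (α ξ : ℝ) :
    HasDerivAt (fun x : ℝ => eF (α * x ^ (n + 1)))
      (eF (α * ξ ^ (n + 1)) * (2 * Real.pi * Complex.I * α * (n + 1) * ξ ^ n)) ξ := by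
  have h1 : HasDerivAt (fun x : ℝ => α * x ^ (n + 1)) (α * ((n + 1 : ℕ) * ξ ^ n)) ξ :=
    (hasDerivAt_pow (n + 1) ξ).const_mul α
  have h2 := (h1.ofReal_comp.const_mul (2 * Real.pi * Complex.I : ℂ)).cexp
  refine h2.congr_deriv ?_
  simp only [eF]
  push_cast
  ring

lemma vInt_eq_mul (k : ℕ) {P : ℝ} (hP : 0 < P) (α : ℝ) :
    vInt k P α = P * vInt k 1 (P ^ k * α) := by
  have h := intervalIntegral.integral_comp_mul_left (a := -1) (b := 1)
    (fun x : ℝ => eF (α * x ^ k)) hP.ne'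
  simp only [vInt]
  have h' : ∀ ξ : ℝ, P ^ k * α * ξ ^ k = α * (P * ξ) ^ k := fun ξ => by ring
  simp only [h', h, mul_neg, mul_one, Complex.real_smul]
  rw [← mul_assoc, ← Complex.ofReal_mul, mul_inv_cancel₀ hP.ne', Complex.ofReal_one, one_mul]

lemma continuous_vInt (k : ℕ) : Continuous (vInt k 1) := by
  unfold vInt
  refine intervalIntegral.continuous_parametric_intervalIntegral_of_continuous' ?_ _ _
  exact continuous_eF.comp (by fun_prop)

lemma norm_vInt_le_two (k : ℕ) (α : ℝ) : ‖vInt k 1 α‖ ≤ 2 := by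
  have h := intervalIntegral.norm_integral_le_of_norm_le_const (a := -1) (b := 1) (C := 1)
    (f := fun ξ : ℝ => eF (α * ξ ^ k)) (fun x _ => (norm_eF _).le)
  refine h.trans ?_
  norm_num

lemma norm_integral_eF_le_s10 (n : ℕ) {α δ : ℝ} (hα : α ≠ 0) (hδ : 0 < δ) (hδ1 : δ ≤ 1) :
    ‖∫ ξ in δ..1, eF (α * ξ ^ (n + 1))‖ ≤ |α|⁻¹ * (δ ^ n)⁻¹ := by
  set c : ℂ := 2 * Real.pi * Complex.I * α * (n + 1) with hc
  have hpi : (Real.pi : ℂ) ≠ 0 := by exact_mod_cast Real.pi_ne_zero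
  have hα' : (α : ℂ) ≠ 0 := by exact_mod_cast hα
  have hn : ((n : ℂ) + 1) ≠ 0 := by exact_mod_cast Nat.succ_ne_zero n
  have hc0 : c ≠ 0 := by
    simp only [hc]
    refine mul_ne_zero (mul_ne_zero (mul_ne_zero (mul_ne_zero two_ne_zero hpi) Complex.I_ne_zero)
      hα') hn
  have hcn : 2 * |α| ≤ ‖c‖ := by
    have : ‖c‖ = 2 * Real.pi * |α| * (n + 1) := by
      simp only [hc, norm_mul, Complex.norm_I, Complex.norm_real, Real.norm_eq_abs,
        abs_of_pos Real.pi_pos, Complex.norm_ofNat]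
      have : ‖((n : ℂ) + 1)‖ = n + 1 := by
        have := Complex.norm_natCast (n + 1)
        push_cast at this; exact this
      rw [this]; ring
    rw [this]
    have h1 : 1 ≤ Real.pi := by linarith [Real.pi_gt_three]
    have h2 : (1 : ℝ) ≤ n + 1 := by linarith [Nat.cast_nonneg (α := ℝ) n]
    calc 2 * |α| = 2 * 1 * |α| * 1 := by ring
      _ ≤ _ := by gcongr
  have hpos : ∀ x ∈ Set.uIcc δ 1, 0 < x := fun x hx => by
    rw [Set.uIcc_of_le hδ1] at hx; exact hδ.trans_le hx.1
  have hr : ∀ x ∈ Set.uIcc δ 1, HasDerivAt (fun y : ℝ => (y ^ n)⁻¹)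
      (-(n * x ^ (n - 1)) / (x ^ n) ^ 2) x := fun x hx =>
    (hasDerivAt_pow n x).fun_inv (pow_ne_zero _ (hpos x hx).ne')
  have hu : ∀ x ∈ Set.uIcc δ 1, HasDerivAt (fun y : ℝ => (((y ^ n)⁻¹ : ℝ) : ℂ))
      ((-(n * x ^ (n - 1)) / (x ^ n) ^ 2 : ℝ) : ℂ) x := fun x hx => (hr x hx).ofReal_comp
  have hv : ∀ x ∈ Set.uIcc δ 1, HasDerivAt (fun y : ℝ => eF (α * y ^ (n + 1)) / c)
      (eF (α * x ^ (n + 1)) * x ^ n) x := fun x _ => by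
    refine ((hasDerivAt_eF_pow n α x).div_const c).congr_deriv ?_
    rw [← hc]; field_simp
  have hci : ContinuousOn (fun x : ℝ => -(n * x ^ (n - 1)) / (x ^ n) ^ 2) (Set.uIcc δ 1) := by
    refine ContinuousOn.div (by fun_prop) (by fun_prop) fun x hx => ?_
    exact pow_ne_zero _ (pow_ne_zero _ (hpos x hx).ne')
  have hcv : Continuous (fun x : ℝ => eF (α * x ^ (n + 1))) :=
    continuous_eF.comp (by fun_prop)
  have ibp := intervalIntegral.integral_mul_deriv_eq_deriv_mul hu hv
    (Complex.continuous_ofReal.comp_continuousOn hci).intervalIntegrable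
    (by
      apply Continuous.intervalIntegrable
      exact hcv.mul (by fun_prop))
  have heq : ∫ ξ in δ..1, eF (α * ξ ^ (n + 1)) =
      ∫ x in δ..1, (((x ^ n)⁻¹ : ℝ) : ℂ) * (eF (α * x ^ (n + 1)) * x ^ n) := by
    refine intervalIntegral.integral_congr fun x hx => ?_
    have : (x : ℂ) ≠ 0 := by exact_mod_cast (hpos x hx).ne'
    simp only [Complex.ofReal_inv, Complex.ofReal_pow]
    field_simp
  have hbd : ‖∫ x in δ..1, ((-(n * x ^ (n - 1)) / (x ^ n) ^ 2 : ℝ) : ℂ) *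
      (eF (α * x ^ (n + 1)) / c)‖ ≤ ((δ ^ n)⁻¹ - 1) * ‖c‖⁻¹ := by
    have h1 := intervalIntegral.norm_integral_le_of_norm_le (μ := volume) hδ1
      (f := fun x => ((-(n * x ^ (n - 1)) / (x ^ n) ^ 2 : ℝ) : ℂ) * (eF (α * x ^ (n + 1)) / c))
      (g := fun x => -(-(n * x ^ (n - 1)) / (x ^ n) ^ 2) * ‖c‖⁻¹)
      (Filter.Eventually.of_forall fun x hx => by
        rw [norm_mul, norm_div, norm_eF, Complex.norm_real, Real.norm_eq_abs, one_div]
        gcongr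
        rw [abs_of_nonpos]
        have : 0 < x := hδ.trans hx.1
        apply div_nonpos_of_nonpos_of_nonneg _ (by positivity)
        rw [neg_nonpos]; positivity)
      ((hci.neg.mul continuousOn_const).intervalIntegrable)
    refine h1.trans (le_of_eq ?_)
    rw [intervalIntegral.integral_mul_const, intervalIntegral.integral_neg,
      intervalIntegral.integral_eq_sub_of_hasDerivAt hr hci.intervalIntegrable]
    simp
  rw [heq, ibp]
  have hcpos : 0 < ‖c‖ := norm_pos_iff.mpr hc0
  have e1 : ‖(((1 ^ n)⁻¹ : ℝ) : ℂ) * (eF (α * 1 ^ (n + 1)) / c)‖ = ‖c‖⁻¹ := by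
    rw [norm_mul, norm_div, norm_eF]; simp
  have e2 : ‖(((δ ^ n)⁻¹ : ℝ) : ℂ) * (eF (α * δ ^ (n + 1)) / c)‖ = (δ ^ n)⁻¹ * ‖c‖⁻¹ := by
    rw [norm_mul, norm_div, norm_eF, Complex.norm_real, Real.norm_eq_abs, one_div,
      abs_of_pos (by positivity)]
  calc _ ≤ ‖c‖⁻¹ + (δ ^ n)⁻¹ * ‖c‖⁻¹ + ((δ ^ n)⁻¹ - 1) * ‖c‖⁻¹ := by
        refine (norm_sub_le _ _).trans (add_le_add ((norm_sub_le _ _).trans ?_) hbd)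
        rw [e1, e2]
    _ = 2 * ‖c‖⁻¹ * (δ ^ n)⁻¹ := by ring
    _ ≤ |α|⁻¹ * (δ ^ n)⁻¹ := by
        have hαp : 0 < |α| := abs_pos.mpr hα
        gcongr
        calc 2 * ‖c‖⁻¹ ≤ 2 * (2 * |α|)⁻¹ := by gcongr
          _ = |α|⁻¹ := by field_simp

lemma norm_integral_zero_one_eF_le {k : ℕ} (hk : 2 ≤ k) {α : ℝ} (hα : 1 ≤ |α|) :
    ‖∫ ξ in (0 : ℝ)..1, eF (α * ξ ^ k)‖ ≤ 2 * |α| ^ (-(1 / k : ℝ)) := by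
  obtain ⟨n, rfl⟩ : ∃ n, k = n + 1 := ⟨k - 1, by omega⟩
  have hα0 : 0 < |α| := by linarith
  set δ : ℝ := |α| ^ (-(1 / ((n + 1 : ℕ) : ℝ))) with hδ
  have hδ0 : 0 < δ := Real.rpow_pos_of_pos hα0 _
  have hδ1 : δ ≤ 1 := Real.rpow_le_one_of_one_le_of_nonpos hα (by
    rw [neg_nonpos]; positivity)
  have hδn : δ ^ (n + 1) = |α|⁻¹ := by
    rw [hδ, ← Real.rpow_natCast, ← Real.rpow_mul hα0.le, ← Real.rpow_neg_one]
    congr 1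
    field_simp
  have hcv : Continuous (fun x : ℝ => eF (α * x ^ (n + 1))) :=
    continuous_eF.comp (by fun_prop)
  rw [← intervalIntegral.integral_add_adjacent_intervals (hcv.intervalIntegrable 0 δ)
    (hcv.intervalIntegrable δ 1)]
  have h1 : ‖∫ ξ in (0 : ℝ)..δ, eF (α * ξ ^ (n + 1))‖ ≤ δ := by
    have h := intervalIntegral.norm_integral_le_of_norm_le_const (a := 0) (b := δ) (C := 1)
      (f := fun ξ : ℝ => eF (α * ξ ^ (n + 1))) (fun x _ => (norm_eF _).le)
    simpa [abs_of_pos hδ0] using h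
  have h2 := norm_integral_eF_le_s10 n (abs_pos.mp hα0) hδ0 hδ1
  rw [← hδn] at h2
  have h3 : δ ^ (n + 1) * (δ ^ n)⁻¹ = δ := by
    rw [pow_succ]; field_simp
  rw [h3] at h2
  linarith [norm_add_le (∫ ξ in (0 : ℝ)..δ, eF (α * ξ ^ (n + 1)))
    (∫ ξ in δ..1, eF (α * ξ ^ (n + 1)))]

lemma norm_vInt_le {k : ℕ} (hk : 2 ≤ k) (α : ℝ) :
    ‖vInt k 1 α‖ ≤ 8 * (1 + |α|) ^ (-(1 / k : ℝ)) := by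
  have hk1 : (1 / k : ℝ) ≤ 1 := by
    rw [div_le_one (by positivity)]
    exact_mod_cast (by omega : 1 ≤ k)
  have hk0 : (0 : ℝ) ≤ 1 / k := by positivity
  have h2 : (2 : ℝ) ^ (1 / k : ℝ) ≤ 2 := by
    simpa using Real.rpow_le_rpow_of_exponent_le (one_le_two) hk1
  rcases le_total 1 |α| with hα | hα
  · have hα0 : 0 < |α| := by linarith
    have hcv : Continuous (fun x : ℝ => eF (α * x ^ k)) := continuous_eF.comp (by fun_prop)
    have hneg : ∫ ξ in (-1 : ℝ)..0, eF (α * ξ ^ k) =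
        ∫ ξ in (0 : ℝ)..1, eF (((-1) ^ k * α) * ξ ^ k) := by
      have h := intervalIntegral.integral_comp_neg (a := 0) (b := 1)
        (fun ξ : ℝ => eF (α * ξ ^ k))
      rw [neg_zero] at h
      rw [← h]
      refine intervalIntegral.integral_congr fun x _ => ?_
      rw [neg_pow x]
      congr 1; ring
    have habs : |(-1) ^ k * α| = |α| := by
      rw [abs_mul, abs_pow, abs_neg, abs_one, one_pow, one_mul]
    have hA := norm_integral_zero_one_eF_le hk hα
    have hB := norm_integral_zero_one_eF_le hk (α := (-1) ^ k * α) (by rwa [habs])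
    rw [habs, ← hneg] at hB
    have hC : |α| ^ (-(1 / k : ℝ)) ≤ 2 * (1 + |α|) ^ (-(1 / k : ℝ)) := by
      calc |α| ^ (-(1 / k : ℝ)) ≤ ((1 + |α|) / 2) ^ (-(1 / k : ℝ)) :=
            Real.rpow_le_rpow_of_nonpos (by positivity) (by linarith) (by linarith)
        _ = (2 : ℝ) ^ (1 / k : ℝ) * (1 + |α|) ^ (-(1 / k : ℝ)) := by
            rw [Real.div_rpow (by positivity) (by norm_num), Real.rpow_neg (by norm_num : (0:ℝ) ≤ 2),
              div_inv_eq_mul, mul_comm]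
        _ ≤ _ := by gcongr
    rw [vInt, ← intervalIntegral.integral_add_adjacent_intervals (hcv.intervalIntegrable _ 0)
      (hcv.intervalIntegrable _ _)]
    linarith [norm_add_le (∫ ξ in (-1 : ℝ)..0, eF (α * ξ ^ k))
      (∫ ξ in (0 : ℝ)..1, eF (α * ξ ^ k))]
  · have h3 : (2 : ℝ) ^ (-(1 / k : ℝ)) ≤ (1 + |α|) ^ (-(1 / k : ℝ)) :=
      Real.rpow_le_rpow_of_nonpos (by positivity) (by linarith) (by linarith)
    have h4 : (1 / 2 : ℝ) ≤ (2 : ℝ) ^ (-(1 / k : ℝ)) := by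
      rw [Real.rpow_neg (by norm_num), one_div]
      gcongr
    linarith [norm_vInt_le_two k α]

lemma norm_prod_vInt_le {k s : ℕ} (hk : 2 ≤ k) {a : ℝ} (ha : 0 < a) (ha1 : a ≤ 1)
    {l : Fin s → ℝ} (hl : ∀ j, a ≤ |l j|) (α : ℝ) :
    ‖∏ j, vInt k 1 (l j * α)‖ ≤ (8 / a) ^ s * (1 + |α|) ^ (-(s / k : ℝ)) := by
  have hk1 : (1 / k : ℝ) ≤ 1 := by
    rw [div_le_one (by positivity)]
    exact_mod_cast (by omega : 1 ≤ k)
  have hk0 : (0 : ℝ) ≤ 1 / k := by positivity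
  have hj : ∀ j, ‖vInt k 1 (l j * α)‖ ≤ 8 / a * (1 + |α|) ^ (-(1 / k : ℝ)) := fun j => by
    refine (norm_vInt_le hk _).trans ?_
    rw [div_mul_eq_mul_div, mul_div_assoc]
    gcongr
    calc (1 + |l j * α|) ^ (-(1 / k : ℝ)) ≤ (a * (1 + |α|)) ^ (-(1 / k : ℝ)) := by
          refine Real.rpow_le_rpow_of_nonpos (by positivity) ?_ (by linarith)
          rw [abs_mul]
          nlinarith [mul_le_mul_of_nonneg_right (hl j) (abs_nonneg α)]
      _ = a ^ (-(1 / k : ℝ)) * (1 + |α|) ^ (-(1 / k : ℝ)) :=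
          Real.mul_rpow ha.le (by positivity)
      _ ≤ a ^ (-1 : ℝ) * (1 + |α|) ^ (-(1 / k : ℝ)) := by
          gcongr ?_ * _
          exact Real.rpow_le_rpow_of_exponent_ge ha ha1 (by linarith)
      _ = _ := by rw [Real.rpow_neg_one]; field_simp
  rw [norm_prod]
  calc ∏ j, ‖vInt k 1 (l j * α)‖ ≤ ∏ _j : Fin s, (8 / a * (1 + |α|) ^ (-(1 / k : ℝ))) :=
        Finset.prod_le_prod (fun _ _ => norm_nonneg _) fun j _ => hj j
    _ = _ := by
        rw [Finset.prod_const, Finset.card_univ, Fintype.card_fin, mul_pow,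
          ← Real.rpow_mul_natCast (by positivity)]
        congr 2; ring


lemma two_lt_div {k s : ℕ} (hk : 2 ≤ k) (hs : 2 * k < s) : (2 : ℝ) < s / k := by
  rw [lt_div_iff₀ (by positivity)]
  exact_mod_cast hs

lemma continuous_prod_vInt (k : ℕ) {s : ℕ} (l : Fin s → ℝ) :
    Continuous fun α : ℝ => ∏ j, vInt k 1 (l j * α) :=
  continuous_finsetProd _ fun _ _ => (continuous_vInt k).comp (by fun_prop)

lemma integrable_one_add_abs_rpow {r : ℝ} (hr : 1 < r) :
    Integrable fun α : ℝ => (1 + |α|) ^ (-r) := by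
  have := integrable_one_add_norm (E := ℝ) (μ := volume) (r := r) (by simpa using hr)
  simpa only [Real.norm_eq_abs] using this

lemma exists_forall_le_abs {s : ℕ} {l : Fin s → ℝ} (hl : ∀ j, l j ≠ 0) :
    ∃ a : ℝ, 0 < a ∧ a ≤ 1 ∧ ∀ j, a ≤ |l j| := by
  have h : ∀ᶠ a : ℝ in nhdsWithin 0 (Set.Ioi 0), ∀ j, a ≤ |l j| := by
    refine Filter.eventually_all.2 fun j => ?_
    filter_upwards [Ioo_mem_nhdsGT (abs_pos.mpr (hl j))] with a ha using ha.2.le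
  obtain ⟨a, ha, ha', h⟩ := (h.and (Ioo_mem_nhdsGT (zero_lt_one' ℝ))).exists
  exact ⟨a, ha', h.le, ha⟩

lemma integrable_prod_vInt {k s : ℕ} (hk : 2 ≤ k) (hs : 2 * k < s) {l : Fin s → ℝ}
    (hl : ∀ j, l j ≠ 0) : Integrable fun α : ℝ => ∏ j, vInt k 1 (l j * α) := by
  obtain ⟨a, ha, ha1, hla⟩ := exists_forall_le_abs hl
  refine ((integrable_one_add_abs_rpow (r := s / k) ?_).const_mul ((8 / a) ^ s)).mono'
    (continuous_prod_vInt k l).aestronglyMeasurable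
    (Filter.Eventually.of_forall fun α => norm_prod_vInt_le hk ha ha1 hla α)
  linarith [two_lt_div hk hs]

lemma continuousOn_integral_prod_vInt {k s : ℕ} (hk : 2 ≤ k) (hs : 2 * k < s) :
    ContinuousOn (fun l : Fin s → ℝ => ∫ α : ℝ, ∏ j, vInt k 1 (l j * α)) {l | ∀ j, l j ≠ 0} := by
  intro l hl
  obtain ⟨a, ha, ha1, hla⟩ := exists_forall_le_abs hl
  refine (continuousAt_of_dominated (F := fun (l : Fin s → ℝ) α => ∏ j, vInt k 1 (l j * α))
    (bound := fun α => (8 / (a / 2)) ^ s * (1 + |α|) ^ (-(s / k : ℝ)))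
    (Filter.Eventually.of_forall fun m => (continuous_prod_vInt k m).aestronglyMeasurable)
    ?_ ?_ ?_).continuousWithinAt
  · have h : ∀ᶠ m : Fin s → ℝ in nhds l, ∀ j, a / 2 < |m j| := by
      refine Filter.eventually_all.2 fun j => ?_
      have hc : Continuous fun m : Fin s → ℝ => |m j| := by fun_prop
      exact hc.continuousAt.eventually (lt_mem_nhds (by linarith [hla j]))
    filter_upwards [h] with m hm
    exact Filter.Eventually.of_forall fun α =>
      norm_prod_vInt_le hk (by linarith) (by linarith) (fun j => (hm j).le) α
  · exact (integrable_one_add_abs_rpow (by linarith [two_lt_div hk hs])).const_mul _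
  · refine Filter.Eventually.of_forall fun α => Continuous.continuousAt ?_
    exact continuous_finsetProd _ fun j _ => (continuous_vInt k).comp (by fun_prop)

/-- The uniform measure on the cube `(-1, 1]^s`. -/
noncomputable def cubeMeasure (s : ℕ) : Measure (Fin s → ℝ) :=
  Measure.pi fun _ => volume.restrict (Set.Ioc (-1 : ℝ) 1)

instance (s : ℕ) : IsFiniteMeasure (cubeMeasure s) := by
  unfold cubeMeasure; infer_instance

/-- The additive form `∑ l_j ξ_j ^ k`. -/
def addForm (k : ℕ) {s : ℕ} (l ξ : Fin s → ℝ) : ℝ := ∑ j, l j * ξ j ^ k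

lemma continuous_addForm (k : ℕ) {s : ℕ} (l : Fin s → ℝ) : Continuous (addForm k l) := by
  unfold addForm; fun_prop

lemma prod_vInt_eq_integral (k : ℕ) {s : ℕ} (l : Fin s → ℝ) (α : ℝ) :
    ∏ j, vInt k 1 (l j * α) = ∫ ξ, eF (α * addForm k l ξ) ∂cubeMeasure s := by
  have h : ∀ ξ : Fin s → ℝ, eF (α * addForm k l ξ) = ∏ j, eF (l j * α * ξ j ^ k) := fun ξ => by
    rw [← eF_sum, addForm, Finset.mul_sum]
    congr 1
    exact Finset.sum_congr rfl fun j _ => by ring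
  simp only [h, cubeMeasure]
  rw [integral_fintype_prod_eq_prod (fun j (x : ℝ) => eF (l j * α * x ^ k))]
  refine Finset.prod_congr rfl fun j _ => ?_
  rw [vInt, intervalIntegral.integral_of_le (by norm_num)]

lemma addForm_update (k : ℕ) {s : ℕ} (l ξ : Fin s → ℝ) (i : Fin s) (t : ℝ) :
    addForm k l (Function.update ξ i t) =
      l i * t ^ k + ∑ j ∈ Finset.univ.erase i, l j * ξ j ^ k := by
  rw [addForm, ← Finset.add_sum_erase _ _ (Finset.mem_univ i), Function.update_self]
  congr 1
  refine Finset.sum_congr rfl fun j hj => ?_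
  rw [Function.update_of_ne (Finset.ne_of_mem_erase hj)]

lemma exists_addForm_update_mul_neg {k s : ℕ} (hk : 2 ≤ k) (hs : 2 ≤ s) {l : Fin s → ℝ}
    (hl : l ∈ Lam k s) : ∃ (i : Fin s) (ξ : Fin s → ℝ), (∀ j, ξ j ∈ Set.Ioo (-1 : ℝ) 1) ∧
      addForm k l (Function.update ξ i 0) * addForm k l (Function.update ξ i 1) < 0 := by
  obtain ⟨hl0, hl1⟩ := hl
  obtain ⟨i, j, hij, σ, hσ, hneg⟩ : ∃ i j : Fin s, i ≠ j ∧ ∃ σ : ℝ, |σ| = 1 ∧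
      l j * σ ^ k * l i < 0 := by
    by_cases h : ∃ i j, l i * l j < 0
    · obtain ⟨i, j, h⟩ := h
      refine ⟨i, j, ?_, 1, abs_one, by simpa [mul_comm] using h⟩
      rintro rfl
      exact absurd h (not_lt.mpr (mul_self_nonneg _))
    · have hodd : Odd k := by
        rw [← Nat.not_even_iff_odd]
        exact fun he => h (hl1 he)
      push Not at h
      refine ⟨⟨0, by omega⟩, ⟨1, by omega⟩, by simp, -1, by simp, ?_⟩
      have := h ⟨0, by omega⟩ ⟨1, by omega⟩
      have h2 : l ⟨0, by omega⟩ * l ⟨1, by omega⟩ ≠ 0 := mul_ne_zero (hl0 _) (hl0 _)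
      have h3 := lt_of_le_of_ne this h2.symm
      rw [hodd.neg_one_pow]
      linarith
  have hi := abs_pos.mpr (hl0 i)
  have hj := abs_pos.mpr (hl0 j)
  obtain ⟨τ, hτ0, hτ1, hτ⟩ : ∃ τ : ℝ, 0 < τ ∧ τ < 1 ∧ |l j| * τ < |l i| := by
    refine ⟨min (1 / 2) (|l i| / (2 * |l j|)), by positivity,
      (min_le_left _ _).trans_lt (by norm_num), ?_⟩
    calc |l j| * min (1 / 2) (|l i| / (2 * |l j|)) ≤ |l j| * (|l i| / (2 * |l j|)) := by
          gcongr; exact min_le_right _ _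
      _ = |l i| / 2 := by field_simp
      _ < |l i| := by linarith
  refine ⟨i, Function.update 0 j (σ * τ), fun m => ?_, ?_⟩
  · rcases eq_or_ne m j with rfl | hm
    · rw [Function.update_self, Set.mem_Ioo, ← abs_lt, abs_mul, hσ, one_mul, abs_of_pos hτ0]
      exact hτ1
    · rw [Function.update_of_ne hm]; simp
  · have hk0 : k ≠ 0 := by omega
    have hsum : ∑ m ∈ Finset.univ.erase i,
        l m * (Function.update (0 : Fin s → ℝ) j (σ * τ)) m ^ k = l j * (σ * τ) ^ k := by
      rw [Finset.sum_eq_single j]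
      · rw [Function.update_self]
      · intro m _ hm
        rw [Function.update_of_ne hm]; simp [hk0]
      · intro h
        simp [hij.symm] at h
    rw [addForm_update, addForm_update, hsum, zero_pow hk0, one_pow]
    set a := l j * (σ * τ) ^ k with ha
    have hneg' : a * l i < 0 := by
      have : a * l i = l j * σ ^ k * l i * τ ^ k := by rw [ha, mul_pow]; ring
      rw [this]
      exact mul_neg_of_neg_of_pos hneg (by positivity)
    have habs : |a| < |l i| := by
      rw [ha, abs_mul, abs_pow, abs_mul, hσ, one_mul, abs_of_pos hτ0]
      refine lt_of_le_of_lt ?_ hτ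
      gcongr
      exact pow_le_of_le_one hτ0.le hτ1.le hk0
    have hna : a * l i = -(|a| * |l i|) := by rw [← abs_mul, abs_of_neg hneg', neg_neg]
    have ha0 : 0 < |a| := abs_pos.mpr fun h => by simp [h] at hneg'
    have : (l i * 0 + a) * (l i * 1 + a) = a * l i + |a| * |a| := by
      rw [abs_mul_abs_self]; ring
    rw [this, hna]
    nlinarith

lemma exists_translate_mem {k s : ℕ} {l : Fin s → ℝ} {i : Fin s} (hk : k ≠ 0)
    (hli : l i ≠ 0) {ξ : Fin s → ℝ} (hξ : ∀ j, ξ j ∈ Set.Ioo (-1 : ℝ) 1)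
    (hneg : addForm k l (Function.update ξ i 0) * addForm k l (Function.update ξ i 1) < 0)
    {η : ℝ} (hη : 0 < η) : ∃ n ∈ Finset.range (⌊2 * (k * |l i|) / η⌋₊ + 1),
      ∃ σ ∈ ({1, -1} : Finset ℝ),
        ξ + Pi.single i (σ * (n * (η / (k * |l i|)))) ∈
          (Set.univ.pi fun _ => Set.Ioc (-1 : ℝ) 1) ∩ {ξ | |addForm k l ξ| ≤ η} := by
  have hL : 0 < k * |l i| := by
    have := abs_pos.mpr hli
    positivity
  set h : ℝ := η / (k * |l i|) with hh
  have hh0 : 0 < h := by positivity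
  have hcont : Continuous fun t : ℝ => addForm k l (Function.update ξ i t) :=
    (continuous_addForm k l).comp (by fun_prop)
  obtain ⟨t, ht, ht0⟩ : ∃ t ∈ Set.Icc (0 : ℝ) 1, addForm k l (Function.update ξ i t) = 0 := by
    have h0 : (0 : ℝ) ∈ Set.uIcc (addForm k l (Function.update ξ i 0))
        (addForm k l (Function.update ξ i 1)) := by
      rw [Set.mem_uIcc]
      rcases mul_neg_iff.mp hneg with h | h
      · exact Or.inr ⟨h.2.le, h.1.le⟩
      · exact Or.inl ⟨h.1.le, h.2.le⟩
    obtain ⟨t, ht, h⟩ := intermediate_value_uIcc hcont.continuousOn h0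
    rw [Set.uIcc_of_le zero_le_one] at ht
    exact ⟨t, ht, h⟩
  set d := t - ξ i with hd
  set n := ⌊|d| / h⌋₊ with hn
  have hn1 : n * h ≤ |d| := by
    rw [← le_div_iff₀ hh0]; exact Nat.floor_le (by positivity)
  have hn2 : |d| < n * h + h := by
    have := Nat.lt_floor_add_one (|d| / h)
    rw [div_lt_iff₀ hh0] at this
    linarith
  have hd2 : |d| ≤ 2 := by
    rw [abs_le, hd]
    constructor <;> linarith [ht.1, ht.2, (hξ i).1, (hξ i).2]
  obtain ⟨σ, hσ, hσd, hσ1⟩ : ∃ σ ∈ ({1, -1} : Finset ℝ), d = σ * |d| ∧ |σ| = 1 := by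
    rcases le_total 0 d with h | h
    · exact ⟨1, by simp, by rw [abs_of_nonneg h, one_mul], abs_one⟩
    · exact ⟨-1, by simp, by rw [abs_of_nonpos h]; ring, by simp⟩
  refine ⟨n, ?_, σ, hσ, ?_⟩
  · rw [Finset.mem_range, Nat.lt_succ_iff]
    refine Nat.floor_le_floor ?_
    rw [hh, div_div_eq_mul_div]
    gcongr
  have hxi : ξ + Pi.single i (σ * (n * h)) = Function.update ξ i (ξ i + σ * (n * h)) := by
    ext j
    rcases eq_or_ne j i with rfl | hj
    · simp
    · simp [hj]
  rw [hxi]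
  set y := ξ i + σ * (n * h) with hy
  have hyt : |y - t| ≤ h := by
    have : y - t = -(σ * (|d| - n * h)) := by
      have : y - t = σ * (n * h) - d := by rw [hy, hd]; ring
      rw [this]; linear_combination -hσd
    rw [this, abs_neg, abs_mul, hσ1, one_mul, abs_of_nonneg (by linarith)]
    linarith
  have hnh : 0 ≤ n * h := by positivity
  have hymem : y ∈ Set.Ioc (-1 : ℝ) 1 := by
    have h1 := (hξ i).1
    have h2 := (hξ i).2
    have h3 := ht.1
    have h4 := ht.2
    have hσ' : σ = 1 ∨ σ = -1 := by simpa using hσ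
    rcases hσ' with rfl | rfl
    · constructor <;> linarith
    · constructor <;> linarith
  refine ⟨fun j _ => ?_, ?_⟩
  · rcases eq_or_ne j i with rfl | hj
    · rw [Function.update_self]; exact hymem
    · rw [Function.update_of_ne hj]; exact ⟨(hξ j).1, (hξ j).2.le⟩
  · have hdiff : addForm k l (Function.update ξ i y) = l i * (y ^ k - t ^ k) := by
      rw [← sub_zero (addForm k l (Function.update ξ i y)), ← ht0, addForm_update, addForm_update]
      ring
    have hpow : |y ^ k - t ^ k| ≤ |y - t| * k := by
      refine (abs_pow_sub_pow_le y t k).trans ?_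
      have : max |y| |t| ^ (k - 1) ≤ 1 := by
        refine pow_le_one₀ (by positivity) (max_le ?_ ?_)
        · rw [abs_le]; exact ⟨hymem.1.le, hymem.2⟩
        · rw [abs_le]; exact ⟨by linarith [ht.1], ht.2⟩
      calc _ ≤ |y - t| * k * 1 := by gcongr
        _ = _ := mul_one _
    rw [Set.mem_ofPred_eq, hdiff, abs_mul]
    calc |l i| * |y ^ k - t ^ k| ≤ |l i| * (h * k) := by
          gcongr
          exact hpow.trans (by gcongr)
      _ = η := by rw [hh]; field_simp

lemma exists_le_cubeMeasure {k s : ℕ} (hk : 2 ≤ k) (hs : 2 ≤ s) {l : Fin s → ℝ}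
    (hl : l ∈ Lam k s) : ∃ c : ℝ, 0 < c ∧ ∀ η : ℝ, 0 < η → η ≤ 1 →
      c * η ≤ (cubeMeasure s).real {ξ | |addForm k l ξ| ≤ η} := by
  obtain ⟨i, ξ₀, hξ₀, hneg₀⟩ := exists_addForm_update_mul_neg hk hs hl
  set U : Set (Fin s → ℝ) := {ξ | (∀ j, ξ j ∈ Set.Ioo (-1 : ℝ) 1) ∧
    addForm k l (Function.update ξ i 0) * addForm k l (Function.update ξ i 1) < 0} with hU
  have hc : ∀ t : ℝ, Continuous fun ξ => addForm k l (Function.update ξ i t) := fun t =>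
    (continuous_addForm k l).comp (by fun_prop)
  have hUo : IsOpen U := by
    have hpi : IsOpen (Set.univ.pi fun _ : Fin s => Set.Ioo (-1 : ℝ) 1) :=
      isOpen_set_pi Set.finite_univ fun _ _ => isOpen_Ioo
    convert hpi.inter (isOpen_lt ((hc 0).mul (hc 1)) (continuous_const (y := (0 : ℝ)))) using 1
    ext ξ
    simp [hU]
  have hUpos : 0 < volume U := hUo.measure_pos volume ⟨ξ₀, hξ₀, hneg₀⟩
  have hUfin : volume U ≠ ⊤ := by
    refine ne_top_of_le_ne_top ?_ (measure_mono (t := Set.Icc (-1 : Fin s → ℝ) 1) ?_)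
    · exact isCompact_Icc.measure_lt_top.ne
    · exact fun ξ hξ => ⟨fun j => (hξ.1 j).1.le, fun j => (hξ.1 j).2.le⟩
  have hL : 0 < k * |l i| := by
    have := abs_pos.mpr (hl.1 i)
    positivity
  set L := k * |l i| with hLdef
  refine ⟨volume.real U / (2 * (2 * L + 1)), ?_, fun η hη hη1 => ?_⟩
  · have := ENNReal.toReal_pos hUpos.ne' hUfin
    rw [Measure.real]; positivity
  set A : Set (Fin s → ℝ) := (Set.univ.pi fun _ => Set.Ioc (-1 : ℝ) 1) ∩
    {ξ | |addForm k l ξ| ≤ η} with hA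
  have hmeas : MeasurableSet {ξ : Fin s → ℝ | |addForm k l ξ| ≤ η} :=
    (isClosed_le (continuous_addForm k l).abs continuous_const).measurableSet
  have hAν : (cubeMeasure s).real {ξ | |addForm k l ξ| ≤ η} = volume.real A := by
    rw [Measure.real, Measure.real, cubeMeasure, ← Measure.restrict_pi_pi,
      Measure.restrict_apply hmeas, Set.inter_comm, ← volume_pi]
  have hAfin : volume A ≠ ⊤ := by
    refine ne_top_of_le_ne_top ?_ (measure_mono (t := Set.Icc (-1 : Fin s → ℝ) 1) ?_)
    · exact isCompact_Icc.measure_lt_top.ne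
    · exact fun ξ hξ => ⟨fun j => (hξ.1 j trivial).1.le, fun j => (hξ.1 j trivial).2⟩
  set N := ⌊2 * L / η⌋₊ with hN
  have hcover : volume.real U ≤ (N + 1) * (2 * volume.real A) := by
    have hsub : U ⊆ ⋃ n ∈ Finset.range (N + 1), ⋃ σ ∈ ({1, -1} : Finset ℝ),
        (fun ξ => ξ + Pi.single i (σ * (n * (η / L)))) ⁻¹' A := by
      intro ξ hξ
      obtain ⟨n, hn, σ, hσ, h⟩ := exists_translate_mem (by omega) (hl.1 i) hξ.1 hξ.2 hη
      simp only [Set.mem_iUnion]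
      exact ⟨n, hn, σ, hσ, h⟩
    have h1 : volume U ≤ ∑ n ∈ Finset.range (N + 1), ∑ σ ∈ ({1, -1} : Finset ℝ), volume A := by
      refine (measure_mono hsub).trans ((measure_biUnion_finset_le _ _).trans ?_)
      refine Finset.sum_le_sum fun n _ => (measure_biUnion_finset_le _ _).trans ?_
      refine Finset.sum_le_sum fun σ _ => le_of_eq ?_
      exact measure_preimage_add_right volume _ _
    have hcard : ({1, -1} : Finset ℝ).card = 2 := Finset.card_pair (by norm_num)
    simp only [Finset.sum_const, Finset.card_range, hcard, nsmul_eq_mul] at h1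
    have h2 := ENNReal.toReal_mono (by finiteness) h1
    have h3 : ((N : ENNReal) + 1).toReal = N + 1 := by
      exact_mod_cast ENNReal.toReal_natCast (N + 1)
    push_cast at h2
    rwa [ENNReal.toReal_mul, ENNReal.toReal_mul, h3, ENNReal.toReal_ofNat] at h2
  have hNle : (N + 1 : ℝ) ≤ (2 * L + 1) / η := by
    have : (N : ℝ) ≤ 2 * L / η := Nat.floor_le (by positivity)
    have h1 : 1 ≤ 1 / η := by rw [le_div_iff₀ hη]; linarith
    rw [add_div]; linarith
  rw [hAν, div_mul_eq_mul_div, div_le_iff₀ (by positivity)]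
  have hA0 : 0 ≤ volume.real A := measureReal_nonneg
  calc volume.real U * η ≤ (2 * L + 1) / η * (2 * volume.real A) * η := by
        gcongr
        exact hcover.trans (by gcongr)
    _ = _ := by field_simp

lemma integral_eF_mul_gaussian (β : ℝ) {η : ℝ} (hη : 0 < η) :
    ∫ α : ℝ, eF (α * β) * Complex.exp (-(Real.pi * η ^ 2 : ℝ) * α ^ 2) =
      ((η⁻¹ * Real.exp (-Real.pi * (β / η) ^ 2) : ℝ) : ℂ) := by
  have hb : 0 < (((Real.pi * η ^ 2 : ℝ) : ℂ)).re := by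
    rw [Complex.ofReal_re]; positivity
  have h := fourierIntegral_gaussian hb (2 * Real.pi * β)
  have e : ∀ α : ℝ, eF (α * β) = Complex.exp (Complex.I * (2 * Real.pi * β) * α) := fun α => by
    rw [eF]; congr 1; push_cast; ring
  simp only [e]
  rw [h]
  have hpi : (Real.pi : ℂ) ≠ 0 := by exact_mod_cast Real.pi_ne_zero
  have hη' : (η : ℂ) ≠ 0 := by exact_mod_cast hη.ne'
  have h1 : (Real.pi / (Real.pi * η ^ 2 : ℝ) : ℂ) ^ (1 / 2 : ℂ) = ((η⁻¹ : ℝ) : ℂ) := by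
    have : (Real.pi / (Real.pi * η ^ 2 : ℝ) : ℂ) = (((η⁻¹) ^ 2 : ℝ) : ℂ) := by
      push_cast; field_simp
    rw [this, show (1 / 2 : ℂ) = ((1 / 2 : ℝ) : ℂ) by push_cast; ring,
      ← Complex.ofReal_cpow (by positivity), ← Real.sqrt_eq_rpow, Real.sqrt_sq (by positivity)]
  rw [h1, Complex.ofReal_mul η⁻¹, Complex.ofReal_exp]
  congr 2
  push_cast
  field_simp
  ring

lemma integral_prod_vInt_mul_gaussian (k : ℕ) {s : ℕ} (l : Fin s → ℝ) {η : ℝ} (hη : 0 < η) :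
    ∫ α : ℝ, (∏ j, vInt k 1 (l j * α)) * Complex.exp (-(Real.pi * η ^ 2 : ℝ) * α ^ 2) =
      ((∫ ξ, η⁻¹ * Real.exp (-Real.pi * (addForm k l ξ / η) ^ 2) ∂cubeMeasure s : ℝ) : ℂ) := by
  have hb : 0 < (((Real.pi * η ^ 2 : ℝ) : ℂ)).re := by
    rw [Complex.ofReal_re]; positivity
  have hg := integrable_cexp_neg_mul_sq hb
  simp only [prod_vInt_eq_integral, ← integral_mul_const]
  rw [integral_integral_swap]
  · simp only [integral_eF_mul_gaussian _ hη]
    rw [integral_complex_ofReal]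
  · have h1 : Integrable (fun z : ℝ × (Fin s → ℝ) =>
        Complex.exp (-(Real.pi * η ^ 2 : ℝ) * z.1 ^ 2) * (1 : ℂ))
        (volume.prod (cubeMeasure s)) := hg.mul_prod (integrable_const 1)
    have hF := continuous_addForm k l
    have hcont : Continuous fun z : ℝ × (Fin s → ℝ) => eF (z.1 * addForm k l z.2) *
        Complex.exp (-(Real.pi * η ^ 2 : ℝ) * z.1 ^ 2) :=
      (continuous_eF.comp (by fun_prop)).mul (by fun_prop)
    refine h1.mono hcont.aestronglyMeasurable (Filter.Eventually.of_forall fun z => le_of_eq ?_)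
    simp only [Function.uncurry, norm_mul, norm_eF, one_mul, mul_one]

lemma re_integral_prod_vInt_pos {k s : ℕ} (hk : 2 ≤ k) (hs : 2 * k < s) {l : Fin s → ℝ}
    (hl : l ∈ Lam k s) : 0 < (∫ α : ℝ, ∏ j, vInt k 1 (l j * α)).re ∧
      (∫ α : ℝ, ∏ j, vInt k 1 (l j * α)).im = 0 := by
  obtain ⟨c, hc, hcη⟩ := exists_le_cubeMeasure hk (by omega) hl
  have htend : Filter.Tendsto (fun η : ℝ => ∫ α : ℝ, (∏ j, vInt k 1 (l j * α)) *
      Complex.exp (-(Real.pi * η ^ 2 : ℝ) * α ^ 2)) (nhdsWithin 0 (Set.Ioi 0))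
      (nhds (∫ α : ℝ, ∏ j, vInt k 1 (l j * α))) := by
    refine tendsto_integral_filter_of_dominated_convergence
      (fun α => ‖∏ j, vInt k 1 (l j * α)‖) (Filter.Eventually.of_forall fun η => ?_)
      (Filter.Eventually.of_forall fun η => Filter.Eventually.of_forall fun α => ?_)
      (integrable_prod_vInt hk hs hl.1).norm (Filter.Eventually.of_forall fun α => ?_)
    · exact ((continuous_prod_vInt k l).mul (by fun_prop)).aestronglyMeasurable
    · rw [norm_mul, Complex.norm_exp]
      refine mul_le_of_le_one_right (norm_nonneg _) (Real.exp_le_one_iff.mpr ?_)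
      have : (-((Real.pi * η ^ 2 : ℝ) : ℂ) * (α : ℂ) ^ 2) =
          ((-(Real.pi * η ^ 2 * α ^ 2) : ℝ) : ℂ) := by push_cast; ring
      rw [this, Complex.ofReal_re, neg_nonpos]
      positivity
    · have hcont : Continuous fun η : ℝ => (∏ j, vInt k 1 (l j * α)) *
          Complex.exp (-(Real.pi * η ^ 2 : ℝ) * α ^ 2) := by fun_prop
      have := hcont.tendsto 0
      simp only [ne_eq, OfNat.ofNat_ne_zero, not_false_eq_true, zero_pow, mul_zero,
        Complex.ofReal_zero, neg_zero, zero_mul, Complex.exp_zero, mul_one] at this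
      exact this.mono_left nhdsWithin_le_nhds
  have hmem : ∀ᶠ η : ℝ in nhdsWithin 0 (Set.Ioi 0), (∫ α : ℝ, (∏ j, vInt k 1 (l j * α)) *
      Complex.exp (-(Real.pi * η ^ 2 : ℝ) * α ^ 2)) ∈
        {z : ℂ | Real.exp (-Real.pi) * c ≤ z.re ∧ z.im = 0} := by
    filter_upwards [Ioo_mem_nhdsGT (zero_lt_one' ℝ)] with η hη
    have hη0 : 0 < η := hη.1
    rw [integral_prod_vInt_mul_gaussian k l hη.1]
    refine ⟨?_, Complex.ofReal_im _⟩
    rw [Complex.ofReal_re]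
    have hint : Integrable (fun ξ => η⁻¹ * Real.exp (-Real.pi * (addForm k l ξ / η) ^ 2))
        (cubeMeasure s) := by
      have hF := continuous_addForm k l
      refine Integrable.of_bound (C := η⁻¹) (by fun_prop)
        (Filter.Eventually.of_forall fun ξ => ?_)
      rw [Real.norm_eq_abs, abs_of_nonneg (by positivity)]
      refine mul_le_of_le_one_right (by positivity) (Real.exp_le_one_iff.mpr ?_)
      rw [neg_mul, neg_nonpos]; positivity
    have hmeas : MeasurableSet {ξ : Fin s → ℝ | |addForm k l ξ| ≤ η} :=
      (isClosed_le (continuous_addForm k l).abs continuous_const).measurableSet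
    calc Real.exp (-Real.pi) * c = η⁻¹ * Real.exp (-Real.pi) * (c * η) := by field_simp
      _ ≤ η⁻¹ * Real.exp (-Real.pi) *
          (cubeMeasure s).real {ξ | |addForm k l ξ| ≤ η} := by
        gcongr; exact hcη η hη.1 hη.2.le
      _ = ∫ ξ in {ξ | |addForm k l ξ| ≤ η}, η⁻¹ * Real.exp (-Real.pi) ∂cubeMeasure s := by
        rw [setIntegral_const, smul_eq_mul, mul_comm]
      _ ≤ ∫ ξ in {ξ | |addForm k l ξ| ≤ η},
          η⁻¹ * Real.exp (-Real.pi * (addForm k l ξ / η) ^ 2) ∂cubeMeasure s := by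
        refine setIntegral_mono_on integrableOn_const hint.integrableOn hmeas fun ξ hξ => ?_
        have h1 : (addForm k l ξ / η) ^ 2 ≤ 1 := by
          rw [sq_le_one_iff_abs_le_one, abs_div, abs_of_pos hη0, div_le_one hη0]
          exact hξ
        gcongr
        nlinarith [Real.pi_pos]
      _ ≤ _ := setIntegral_le_integral hint
          (Filter.Eventually.of_forall fun ξ => by positivity)
  have hclosed : IsClosed {z : ℂ | Real.exp (-Real.pi) * c ≤ z.re ∧ z.im = 0} :=
    (isClosed_le continuous_const Complex.continuous_re).inter
      (isClosed_eq Complex.continuous_im continuous_const)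
  have h := hclosed.mem_of_tendsto htend hmem
  exact ⟨lt_of_lt_of_le (by positivity) h.1, h.2⟩

lemma abs_sinc_sq_sub_one_le (x : ℝ) : |Real.sinc x ^ 2 - 1| ≤ |x| := by
  wlog hx : 0 ≤ x generalizing x
  · have := this (-x) (by linarith)
    rwa [Real.sinc_neg, abs_neg] at this
  rcases hx.eq_or_lt with rfl | hx
  · simp
  have h1 : Real.sinc x ^ 2 ≤ 1 := (sq_le_one_iff_abs_le_one _).mpr (Real.abs_sinc_le_one x)
  rw [abs_of_nonpos (by linarith), abs_of_pos hx]
  rcases le_total 1 x with h | h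
  · nlinarith [sq_nonneg (Real.sinc x)]
  · have h2 : 1 - x ^ 2 / 6 ≤ Real.sinc x := by
      rw [Real.sinc_of_ne_zero hx.ne', le_div_iff₀ hx]
      linarith [Real.sin_gt_sub_cube hx]
    have h3 : (1 - x ^ 2 / 6) ^ 2 ≤ Real.sinc x ^ 2 :=
      pow_le_pow_left₀ (by nlinarith) h2 2
    nlinarith [sq_nonneg (x ^ 2)]

lemma integral_dEta {η : ℝ} (hη : 0 < η) (f : ℝ → ℂ) :
    ∫ α, f α ∂dEta η = ∫ α, ((η * Real.sinc (Real.pi * η * α) ^ 2 : ℝ) : ℂ) * f α := by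
  rw [dEta, integral_withDensity_eq_integral_toReal_smul (by fun_prop)
    (Filter.Eventually.of_forall fun _ => ENNReal.ofReal_lt_top)]
  have h0 : ∀ᵐ α : ℝ, α ≠ 0 := by simp [ae_iff]
  refine integral_congr_ae (h0.mono fun α hα => ?_)
  have hne : Real.pi * η * α ≠ 0 := by
    have := Real.pi_ne_zero
    have := hη.ne'
    positivity
  simp only
  rw [Real.sinc_of_ne_zero hne, ENNReal.toReal_ofReal (by positivity), Complex.real_smul]

lemma integral_prod_vInt_dEta (k : ℕ) {s : ℕ} (l : Fin s → ℝ) {P η : ℝ} (hP : 0 < P)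
    (hη : 0 < η) :
    ∫ α, ∏ j, vInt k P (l j * α) ∂dEta η =
      ((P ^ s * (P ^ k)⁻¹ : ℝ) : ℂ) * ∫ u : ℝ,
        ((η * Real.sinc (Real.pi * η * (u / P ^ k)) ^ 2 : ℝ) : ℂ) *
          ∏ j, vInt k 1 (l j * u) := by
  have hPk : 0 < P ^ k := by positivity
  have h := Measure.integral_comp_mul_left (fun u : ℝ =>
    ((η * Real.sinc (Real.pi * η * (u / P ^ k)) ^ 2 : ℝ) : ℂ) * ∏ j, vInt k 1 (l j * u)) (P ^ k)
  rw [abs_of_pos (by positivity), Complex.real_smul] at h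
  rw [integral_dEta hη, Complex.ofReal_mul, mul_assoc, ← h, ← integral_const_mul]
  refine integral_congr_ae (Filter.Eventually.of_forall fun α => ?_)
  simp only [vInt_eq_mul k hP, Finset.prod_mul_distrib, Finset.prod_const, Finset.card_univ,
    Fintype.card_fin, mul_div_cancel_left₀ α hPk.ne']
  have : ∀ j, P ^ k * (l j * α) = l j * (P ^ k * α) := fun j => by ring
  simp only [this, Complex.ofReal_pow]
  ring

lemma norm_integral_sinc_sub_le {k s : ℕ} (hk : 2 ≤ k) (hs : 2 * k < s) {a : ℝ} (ha : 0 < a)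
    (ha1 : a ≤ 1) {l : Fin s → ℝ} (hl : ∀ j, a ≤ |l j|) {η b : ℝ} (hη : 0 < η) (hη2 : η ≤ 2)
    (hb : 0 < b) :
    ‖(∫ u : ℝ, ((η * Real.sinc (Real.pi * η * (u / b)) ^ 2 : ℝ) : ℂ) *
        ∏ j, vInt k 1 (l j * u)) - η * ∫ u : ℝ, ∏ j, vInt k 1 (l j * u)‖ ≤
      4 * Real.pi * (8 / a) ^ s * (∫ u : ℝ, (1 + |u|) ^ (-(s / k - 1 : ℝ))) * b⁻¹ := by
  have hint := integrable_prod_vInt hk hs (l := l)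
    fun j => abs_pos.mp (ha.trans_le (hl j))
  have hint' : Integrable fun u : ℝ => ((η * Real.sinc (Real.pi * η * (u / b)) ^ 2 : ℝ) : ℂ) *
      ∏ j, vInt k 1 (l j * u) := by
    refine hint.bdd_mul (c := η) ?_ (Filter.Eventually.of_forall fun u => ?_)
    · have := Real.continuous_sinc
      exact Continuous.aestronglyMeasurable (by fun_prop)
    · rw [Complex.norm_real, Real.norm_eq_abs, abs_of_nonneg (by positivity)]
      exact mul_le_of_le_one_right hη.le
        ((sq_le_one_iff_abs_le_one _).mpr (Real.abs_sinc_le_one _))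
  rw [← integral_const_mul, ← integral_sub hint' (hint.const_mul _), ← integral_const_mul,
    ← integral_mul_const]
  have hr : 1 < (s / k - 1 : ℝ) := by linarith [two_lt_div hk hs]
  refine norm_integral_le_of_norm_le
    (((integrable_one_add_abs_rpow hr).const_mul _).mul_const _)
    (Filter.Eventually.of_forall fun u => ?_)
  have h1 : ((η * Real.sinc (Real.pi * η * (u / b)) ^ 2 : ℝ) : ℂ) * ∏ j, vInt k 1 (l j * u) -
      η * ∏ j, vInt k 1 (l j * u) =
      ((η * (Real.sinc (Real.pi * η * (u / b)) ^ 2 - 1) : ℝ) : ℂ) *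
        ∏ j, vInt k 1 (l j * u) := by push_cast; ring
  rw [h1, norm_mul, Complex.norm_real, Real.norm_eq_abs, abs_mul, abs_of_pos hη]
  have h2 : |Real.sinc (Real.pi * η * (u / b)) ^ 2 - 1| ≤ Real.pi * 2 * ((1 + |u|) / b) := by
    refine (abs_sinc_sq_sub_one_le _).trans ?_
    rw [abs_mul, abs_mul, abs_of_pos Real.pi_pos, abs_of_pos hη, abs_div, abs_of_pos hb]
    have := Real.pi_pos
    gcongr
    linarith
  have h3 : (1 + |u|) ^ (-(s / k - 1 : ℝ)) = (1 + |u|) * (1 + |u|) ^ (-(s / k : ℝ)) := by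
    rw [← Real.rpow_one_add' (by positivity) (by linarith)]
    congr 1; ring
  rw [h3]
  calc η * |Real.sinc (Real.pi * η * (u / b)) ^ 2 - 1| * ‖∏ j, vInt k 1 (l j * u)‖ ≤
        2 * (Real.pi * 2 * ((1 + |u|) / b)) * ((8 / a) ^ s * (1 + |u|) ^ (-(s / k : ℝ))) := by
        have := norm_prod_vInt_le hk ha ha1 hl u
        gcongr
    _ = _ := by ring

/-- For k ≥ 2, s > 2k, C ≥ 2 there is a continuous positive function
J_{k,s} on Λ_k^{(s)} with ∫ V_λ(α) d_ηα = η J_{k,s}(λ) P^{s−k} + O(P^{s−2k}),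
uniformly for 0 < η ≤ 2 and λ ∈ Λ_k^{(s)}(C). -/
theorem stmt10 (k s : ℕ) (hk : 2 ≤ k) (hs : 2 * k < s) (C : ℝ) (hC : 2 ≤ C) :
    ∃ J : (Fin s → ℝ) → ℝ, ContinuousOn J (Lam k s) ∧ (∀ l ∈ Lam k s, 0 < J l) ∧
      ∃ c : ℝ, 0 < c ∧ ∀ P : ℝ, 2 ≤ P → ∀ η : ℝ, 0 < η → η ≤ 2 → ∀ l ∈ LamC k s C,
        ‖(∫ α, ∏ j, vInt k P (l j * α) ∂dEta η) -
            ((η * J l * P ^ ((s : ℝ) - k) : ℝ) : ℂ)‖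
          ≤ c * P ^ ((s : ℝ) - 2 * k) := by
  refine ⟨fun l => (∫ α : ℝ, ∏ j, vInt k 1 (l j * α)).re,
    Complex.continuous_re.comp_continuousOn
      ((continuousOn_integral_prod_vInt hk hs).mono fun l hl => hl.1),
    fun l hl => (re_integral_prod_vInt_pos hk hs hl).1,
    4 * Real.pi * (8 / (1 / C)) ^ s * (∫ u : ℝ, (1 + |u|) ^ (-(s / k - 1 : ℝ))) + 1, ?_, ?_⟩
  · have : 0 ≤ ∫ u : ℝ, (1 + |u|) ^ (-(s / k - 1 : ℝ)) :=
      integral_nonneg fun u => by positivity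
    positivity
  intro P hP η hη hη2 l hl
  have hP0 : 0 < P := by linarith
  have hC0 : 0 < C := by linarith
  have hre : (((∫ α : ℝ, ∏ j, vInt k 1 (l j * α)).re : ℝ) : ℂ) =
      ∫ α : ℝ, ∏ j, vInt k 1 (l j * α) :=
    Complex.ext (Complex.ofReal_re _)
      ((Complex.ofReal_im _).trans (re_integral_prod_vInt_pos hk hs hl.1).2.symm)
  have hp1 : P ^ ((s : ℝ) - k) = P ^ s * (P ^ k)⁻¹ := by
    rw [Real.rpow_sub hP0, Real.rpow_natCast, Real.rpow_natCast, div_eq_mul_inv]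
  have hp2 : P ^ ((s : ℝ) - 2 * k) = P ^ s * (P ^ k)⁻¹ * (P ^ k)⁻¹ := by
    rw [show (s : ℝ) - 2 * k = s - k - k by ring, Real.rpow_sub hP0, hp1, Real.rpow_natCast,
      div_eq_mul_inv]
  have hmain := norm_integral_sinc_sub_le hk hs (a := 1 / C) (by positivity)
    ((div_le_one hC0).mpr (by linarith)) (fun j => (hl.2 j).1) hη hη2 (pow_pos hP0 k)
  have hpos : 0 < P ^ s * (P ^ k)⁻¹ := by positivity
  rw [integral_prod_vInt_dEta k l hP0 hη, hp1, hp2, mul_comm (η * _), Complex.ofReal_mul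
    (P ^ s * (P ^ k)⁻¹), Complex.ofReal_mul η, hre, ← mul_sub, norm_mul, Complex.norm_real,
    Real.norm_eq_abs, abs_of_pos hpos]
  calc _ ≤ P ^ s * (P ^ k)⁻¹ * (4 * Real.pi * (8 / (1 / C)) ^ s *
        (∫ u : ℝ, (1 + |u|) ^ (-(s / k - 1 : ℝ))) * (P ^ k)⁻¹) := by gcongr
    _ = (4 * Real.pi * (8 / (1 / C)) ^ s * (∫ u : ℝ, (1 + |u|) ^ (-(s / k - 1 : ℝ)))) *
        (P ^ s * (P ^ k)⁻¹ * (P ^ k)⁻¹) := by ring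
    _ ≤ _ := by
        gcongr
        linarith
end
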